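/- The group Q_{4,2} is presented by the generators x, y and the relations: y³ = 1; x⁴ = 1 and b_i⁴ = 1 for every integer i ≥ 1; and [x², yxy] = 1 and [b_i², yxy] = 1 for every integer i ≥ 1; where b_i denotes the word [x, (yxy)^{−i}]. Precisely, the homomorphism from the free group on two generators x, y onto Q_{4,2} sending x ↦ p(X) and y ↦ p(Y) is surjective with kernel the normal closure of the corresponding set of relators. -/

import Mathlib

/-!
Common setup: the commutator convention `[a,b] = a⁻¹b⁻¹ab` of the paper, the sequence
`x₀ = x`, `x_{i+1} = [yxy, x_i]`, the Laurent polynomial ring `R = 𝔽₂[t,t⁻¹]`, and the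
images `X`, `Y` of `σ₁σ₂σ₃` and `σ₁σ₂σ₃σ₁` in `GL(3, R)` under the mod-2 reduced Burau
representation of the 4-strand braid group.
-/

open Matrix LaurentPolynomial

noncomputable section

set_option maxRecDepth 100000

/-- The paper's commutator convention: `[a,b] = a⁻¹b⁻¹ab`. -/
def br {G : Type*} [Group G] (a b : G) : G := a⁻¹ * b⁻¹ * a * b

/-- The recursively defined elements `x₀ = x`, `x_{i+1} = [yxy, x_i]`. -/
def xseq {G : Type*} [Group G] (x y : G) : ℕ → G
  | 0 => x
  | n + 1 => br (y * x * y) (xseq x y n)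

/-- `R = 𝔽₂[t,t⁻¹]`, the ring of Laurent polynomials over the field with two elements. -/
abbrev R2 : Type := LaurentPolynomial (ZMod 2)

instance : CharP R2 2 := charP_of_injective_algebraMap (algebraMap (ZMod 2) R2).injective 2

/-- The matrix `X = t·!![0,0,1; 1,0,1; 0,1,1]`. -/
def Xmat : Matrix (Fin 3) (Fin 3) R2 := (T 1 : R2) • !![0,0,1; 1,0,1; 0,1,1]

/-- The matrix `Y = t·!![0,0,1; t,1,1; 0,1,1]`. -/
def Ymat : Matrix (Fin 3) (Fin 3) R2 := (T 1 : R2) • !![0,0,1; T 1,1,1; 0,1,1]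

/-- An explicit inverse for `Xmat`. -/
def Xmatinv : Matrix (Fin 3) (Fin 3) R2 := (T (-1) : R2) • !![1,1,0; 1,0,1; 1,0,0]

/-- An explicit inverse for `Ymat`. -/
def Ymatinv : Matrix (Fin 3) (Fin 3) R2 := (T (-2) : R2) • !![0,1,1; T 1,0,T 1; T 1,0,0]

lemma Xmat_mul_Xmatinv : Xmat * Xmatinv = 1 := by
  rw [Xmat, Xmatinv, Matrix.smul_mul, Matrix.mul_smul, smul_smul, ← T_add]
  simp only [Matrix.mul_fin_three, mul_zero, zero_mul, mul_one, one_mul, add_zero, zero_add,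
    ← T_add, CharTwo.add_self_eq_zero]
  rw [Matrix.one_fin_three]
  simp only [Matrix.smul_of, Matrix.smul_cons, smul_eq_mul, Matrix.smul_empty, ← T_add,
    mul_zero, mul_one]
  norm_num [T_zero]

lemma Xmatinv_mul_Xmat : Xmatinv * Xmat = 1 := by
  rw [Xmat, Xmatinv, Matrix.smul_mul, Matrix.mul_smul, smul_smul, ← T_add]
  simp only [Matrix.mul_fin_three, mul_zero, zero_mul, mul_one, one_mul, add_zero, zero_add,
    ← T_add, CharTwo.add_self_eq_zero]
  rw [Matrix.one_fin_three]
  simp only [Matrix.smul_of, Matrix.smul_cons, smul_eq_mul, Matrix.smul_empty, ← T_add,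
    mul_zero, mul_one]
  norm_num [T_zero]

lemma Ymat_mul_Ymatinv : Ymat * Ymatinv = 1 := by
  rw [Ymat, Ymatinv, Matrix.smul_mul, Matrix.mul_smul, smul_smul, ← T_add]
  simp only [Matrix.mul_fin_three, mul_zero, zero_mul, mul_one, one_mul, add_zero, zero_add,
    ← T_add, CharTwo.add_self_eq_zero]
  rw [Matrix.one_fin_three]
  simp only [Matrix.smul_of, Matrix.smul_cons, smul_eq_mul, Matrix.smul_empty, ← T_add,
    mul_zero, mul_one]
  norm_num [T_zero]

lemma Ymatinv_mul_Ymat : Ymatinv * Ymat = 1 := by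
  rw [Ymat, Ymatinv, Matrix.mul_smul, Matrix.smul_mul, smul_smul, ← T_add]
  simp only [Matrix.mul_fin_three, mul_zero, zero_mul, mul_one, one_mul, add_zero, zero_add,
    ← T_add, CharTwo.add_self_eq_zero]
  rw [Matrix.one_fin_three]
  simp only [Matrix.smul_of, Matrix.smul_cons, smul_eq_mul, Matrix.smul_empty, ← T_add,
    mul_zero, mul_one]
  norm_num [T_zero]

/-- `X ∈ GL(3, 𝔽₂[t,t⁻¹])`, the mod-2 reduced Burau image of `σ₁σ₂σ₃`. -/
def X : GL (Fin 3) R2 := ⟨Xmat, Xmatinv, Xmat_mul_Xmatinv, Xmatinv_mul_Xmat⟩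

/-- `Y ∈ GL(3, 𝔽₂[t,t⁻¹])`, the mod-2 reduced Burau image of `σ₁σ₂σ₃σ₁`. -/
def Y : GL (Fin 3) R2 := ⟨Ymat, Ymatinv, Ymat_mul_Ymatinv, Ymatinv_mul_Ymat⟩

/-- `PGL(3, R)`, the projective general linear group: `GL(3,R)` modulo its center
(the subgroup of scalars). -/
abbrev PGL3 : Type := GL (Fin 3) R2 ⧸ Subgroup.center (GL (Fin 3) R2)

/-- The natural projection `p : GL(3,R) → PGL(3,R)`. -/
def pp : GL (Fin 3) R2 →* PGL3 := QuotientGroup.mk' (Subgroup.center (GL (Fin 3) R2))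

/-- `Q_{4,2}`, the subgroup of `PGL(3,R)` generated by `p(X)` and `p(Y)`. -/
abbrev Q42 : Subgroup PGL3 := Subgroup.closure {pp X, pp Y}

/-- The generator `x` of the free group on `x, y`. -/
def fx : FreeGroup (Fin 2) := FreeGroup.of 0

/-- The generator `y` of the free group on `x, y`. -/
def fy : FreeGroup (Fin 2) := FreeGroup.of 1

/-- The word `b_i = [x, (yxy)^{-i}]`, for `i ≥ 1`. -/
def bwd (i : ℕ) : FreeGroup (Fin 2) := br fx ((fy * fx * fy) ^ (-(i : ℤ)))

/-- The relators of Lemma A.6: `y³`; `x⁴` and `b_i⁴` for `i ≥ 1`; and `[x², yxy]` and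
`[b_i², yxy]` for `i ≥ 1`. -/
def q42RelsC : Set (FreeGroup (Fin 2)) :=
  {fy ^ 3, fx ^ 4, br (fx ^ 2) (fy * fx * fy)} ∪
    {r | ∃ i : ℕ, 1 ≤ i ∧ r = bwd i ^ 4} ∪
    {r | ∃ i : ℕ, 1 ≤ i ∧ r = br (bwd i ^ 2) (fy * fx * fy)}


set_option linter.all false
set_option maxRecDepth 100000

section GroupPart

variable {G : Type*} [Group G]

lemma even_list {ι : Type*} [DecidableEq ι] (f : ι → G) (C : Subgroup G)
    (hC : ∀ c ∈ C, ∀ i, Commute c (f i)) (hsq : ∀ i, f i * f i ∈ C)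
    (hcomm : ∀ i j, ∃ c ∈ C, f i * f j = f j * f i * c) :
    ∀ n : ℕ, ∀ l : List ι, l.length ≤ n → (∀ i, Even (l.count i)) → (l.map f).prod ∈ C := by
  have hlist : ∀ (l : List ι) (i : ι), ∃ c ∈ C, f i * (l.map f).prod = (l.map f).prod * f i * c := by
    intro l i
    induction l with
    | nil => exact ⟨1, C.one_mem, by simp⟩
    | cons j l ih =>
      obtain ⟨c, hc, h⟩ := ih
      obtain ⟨c', hc', h'⟩ := hcomm i j
      have hcl : ∀ l : List ι, Commute c' (l.map f).prod := by
        intro l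
        induction l with
        | nil => simp
        | cons k l ih => simpa using (hC c' hc' k).mul_right ih
      refine ⟨c * c', C.mul_mem hc hc', ?_⟩
      simp only [List.map_cons, List.prod_cons]
      calc f i * (f j * (l.map f).prod) = (f i * f j) * (l.map f).prod := by group
        _ = f j * f i * (c' * (l.map f).prod) := by rw [h']; group
        _ = f j * (f i * (l.map f).prod) * c' := by rw [(hcl l).eq]; group
        _ = _ := by rw [h]; group
  intro n
  induction n with
  | zero =>
    intro l hl _
    have : l = [] := by simpa using hl
    subst this
    simp
  | succ n ih =>
    intro l hl he
    cases l with
    | nil => simp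
    | cons i l =>
      have hi : i ∈ l := by
        by_contra hi
        have := he i
        rw [List.count_cons_self, List.count_eq_zero_of_not_mem hi] at this
        exact absurd this (by decide)
      obtain ⟨l1, l2, rfl⟩ := List.append_of_mem hi
      obtain ⟨c, hc, h⟩ := hlist l1 i
      have hmem : ((l1 ++ l2).map f).prod ∈ C := by
        apply ih
        · simp at hl ⊢; omega
        · intro k
          have := he k
          simp only [List.count_cons, List.count_append] at this ⊢
          split_ifs at this <;> [skip; simpa using this]
          rw [Nat.even_iff] at this ⊢
          omega
      have : ((i :: (l1 ++ i :: l2)).map f).prod = (c * (f i * f i)) * ((l1 ++ l2).map f).prod := by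
        have hcl : ∀ x ∈ C, ∀ l : List ι, Commute x (l.map f).prod := by
          intro x hx l
          induction l with
          | nil => simp
          | cons k l ih => simpa using (hC x hx k).mul_right ih
        simp only [List.map_cons, List.prod_cons, List.map_append, List.prod_append]
        calc f i * ((l1.map f).prod * (f i * (l2.map f).prod))
            = (f i * (l1.map f).prod) * f i * (l2.map f).prod := by group
          _ = (l1.map f).prod * f i * (c * f i) * (l2.map f).prod := by rw [h]; group
          _ = (l1.map f).prod * (f i * f i * c) * (l2.map f).prod := by
            rw [(hC c hc i).eq]; group
          _ = (f i * f i * c) * (l1.map f).prod * (l2.map f).prod := by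
            rw [(hcl _ (C.mul_mem (hsq i) hc) l1).eq]
          _ = _ := by
            rw [← (hC c hc i).mul_right (hC c hc i) |>.eq]; group
      rw [this]
      exact C.mul_mem (C.mul_mem hc (hsq i)) hmem

lemma comm_sq {p q c : G} (hp : p ^ 2 = c) (hq : q ^ 2 = c) :
    p * q = q * p * (p⁻¹ * q) ^ 2 := by
  have h1 : p⁻¹ = p * c⁻¹ := by rw [← hp]; group
  have h2 : Commute c p := by rw [← hp]; exact Commute.pow_left rfl 2
  have h3 : Commute c q := by rw [← hq]; exact Commute.pow_left rfl 2
  have : q * p * (p⁻¹ * q) ^ 2 = q * q * p⁻¹ * q := by rw [pow_two]; group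
  rw [this, h1, ← pow_two, hq]
  rw [h2.inv_left.eq.symm]; group

/-- The relations of the presentation, in a group. -/
structure Rels (x y : G) : Prop where
  hy : y ^ 3 = 1
  hx : x ^ 4 = 1
  hxz : Commute (x ^ 2) (y * x * y)
  hb : ∀ i : ℕ, 1 ≤ i → (x⁻¹ * ((y * x * y) ^ i * x * ((y * x * y) ^ i)⁻¹)) ^ 4 = 1
  hbz : ∀ i : ℕ, 1 ≤ i →
    Commute ((x⁻¹ * ((y * x * y) ^ i * x * ((y * x * y) ^ i)⁻¹)) ^ 2) (y * x * y)

/-- conjugates of `x` by powers of `d`. -/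
def xd (x d : G) (i : ℤ) : G := d ^ i * x * (d ^ i)⁻¹

/-- the central elements -/
def cd (x d : G) (k : ℕ) : G := if k = 0 then x ^ 2 else (x⁻¹ * xd x d k) ^ 2

def XL (x d : G) (l : List ℤ) : G := (l.map (xd x d)).prod
def CL (x d : G) (m : List ℕ) : G := (m.map (cd x d)).prod

variable {x y : G}

lemma Rels.comm_x2_d (h : Rels x y) : Commute (x ^ 2) (y * x * y * x) :=
  h.hxz.mul_right (Commute.pow_left rfl 2)

lemma conj_pow' (g x : G) (n : ℕ) : (g * x * g⁻¹) ^ n = g * x ^ n * g⁻¹ := conj_pow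

lemma conj_x2 {d : G} (h : Commute (x ^ 2) d) (i : ℤ) : (xd x d i) ^ 2 = x ^ 2 := by
  rw [xd, conj_pow, ← (h.zpow_right i).eq]; group

lemma Rels.bz_x (h : Rels x y) (i : ℕ) (hi : 1 ≤ i) :
    Commute ((x⁻¹ * ((y * x * y) ^ i * x * ((y * x * y) ^ i)⁻¹)) ^ 2) x := by
  set z := y * x * y
  set q := z ^ i * x * (z ^ i)⁻¹ with hq
  have hq2 : q ^ 2 = x ^ 2 := by
    have hc : Commute (x ^ 2) z := h.hxz
    rw [hq, conj_pow, ← (hc.pow_right i).eq, mul_inv_cancel_right]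
  have h2 : Commute (x ^ 2) q := by rw [← hq2]; exact Commute.pow_left rfl 2
  have h1 : x⁻¹ * (x⁻¹ * q) * x = (x⁻¹ * q)⁻¹ := by
    have e1 : x⁻¹ * (x⁻¹ * q) * x = (x ^ 2)⁻¹ * q * x := by rw [pow_two]; group
    rw [e1, h2.inv_left.eq]
    rw [← hq2]; group
  have h4 := h.hb i hi
  have h5 : ((x⁻¹ * q) ^ 2)⁻¹ = (x⁻¹ * q) ^ 2 := by
    rw [inv_eq_iff_mul_eq_one, ← pow_add]; exact h4
  have h6 : x⁻¹ * (x⁻¹ * q) ^ 2 * x = (x⁻¹ * q) ^ 2 := by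
    have : x⁻¹ * (x⁻¹ * q) ^ 2 * x = (x⁻¹ * (x⁻¹ * q) * x) ^ 2 := by
      rw [pow_two, pow_two]; group
    rw [this, h1, inv_pow, h5]
  change _ = _
  calc (x⁻¹ * q) ^ 2 * x = x * (x⁻¹ * (x⁻¹ * q) ^ 2 * x) := by group
    _ = _ := by rw [h6]

lemma Rels.xd_eq (h : Rels x y) (k : ℕ) : ∃ γ : G, Commute γ x ∧ Commute γ (y * x * y) ∧ γ ^ 2 = 1 ∧
    xd x (y * x * y * x) k = (y * x * y) ^ k * x * ((y * x * y) ^ k)⁻¹ * γ := by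
  set z := y * x * y with hz
  induction k with
  | zero => exact ⟨1, by simp, by simp, by simp, by simp [xd]⟩
  | succ k ih =>
    obtain ⟨γ, h1, h2, h3, h4⟩ := ih
    have h5 : xd x (z * x) (k + 1 : ℕ) = (z * x) * xd x (z * x) k * (z * x)⁻¹ := by
      simp only [xd, zpow_natCast, pow_succ', _root_.mul_inv_rev, mul_assoc]
    have hstep : ∃ δ, Commute δ x ∧ Commute δ z ∧ δ ^ 2 = 1 ∧
        x * (z ^ k * x * (z ^ k)⁻¹) * x⁻¹ = (z ^ k * x * (z ^ k)⁻¹) * δ := by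
      rcases Nat.eq_zero_or_pos k with rfl | hk
      · exact ⟨1, by simp⟩
      · refine ⟨_, h.bz_x k hk, h.hbz k hk, by rw [← pow_mul]; exact h.hb k hk, ?_⟩
        set q := z ^ k * x * (z ^ k)⁻¹ with hq
        have hq2 : q ^ 2 = x ^ 2 := by
          have hc : Commute (x ^ 2) z := h.hxz
          rw [hq, conj_pow, ← (hc.pow_right k).eq, mul_inv_cancel_right]
        have := comm_sq (p := x) (q := q) rfl hq2
        rw [this]
        have h7 := (h.bz_x k hk).inv_right.eq
        rw [← hz, ← hq] at h7
        calc q * x * (x⁻¹ * q) ^ 2 * x⁻¹ = q * x * ((x⁻¹ * q) ^ 2 * x⁻¹) := by group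
          _ = _ := by rw [h7]; group
    obtain ⟨δ, d1, d2, d3, d4⟩ := hstep
    have hγδ : Commute γ δ := by
      have : δ = (z ^ k * x * (z ^ k)⁻¹)⁻¹ * (x * (z ^ k * x * (z ^ k)⁻¹) * x⁻¹) := by
        rw [d4]; group
      rw [this]
      have a1 : Commute γ (z ^ k * x * (z ^ k)⁻¹) :=
        ((h2.pow_right k).mul_right h1).mul_right (h2.pow_right k).inv_right
      exact a1.inv_right.mul_right ((h1.mul_right a1).mul_right h1.inv_right)
    refine ⟨δ * γ, d1.mul_left h1, d2.mul_left h2, ?_, ?_⟩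
    · rw [hγδ.symm.mul_pow, d3, h3, one_mul]
    · rw [h5, h4]
      calc z * x * (z ^ k * x * (z ^ k)⁻¹ * γ) * (z * x)⁻¹
          = z * x * (z ^ k * x * (z ^ k)⁻¹) * (γ * (z * x)⁻¹) := by group
        _ = z * (x * (z ^ k * x * (z ^ k)⁻¹) * x⁻¹) * (z⁻¹ * γ) := by
            rw [(h2.mul_right h1).inv_right.eq]; group
        _ = z * (z ^ k * x * (z ^ k)⁻¹) * (δ * z⁻¹) * γ := by rw [d4]; group
        _ = z ^ (k + 1) * x * (z ^ (k + 1))⁻¹ * (δ * γ) := by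
            rw [d2.inv_right.eq, pow_succ']; group

lemma Rels.cd_props (h : Rels x y) (k : ℕ) : Commute (cd x (y * x * y * x) k) x ∧
    Commute (cd x (y * x * y * x) k) (y * x * y * x) ∧ cd x (y * x * y * x) k ^ 2 = 1 := by
  rw [cd]
  split_ifs with hk
  · exact ⟨Commute.pow_left rfl 2, h.comm_x2_d, by rw [← pow_mul]; exact h.hx⟩
  · have hk : 1 ≤ k := by omega
    obtain ⟨γ, h1, h2, h3, h4⟩ := h.xd_eq k
    set z := y * x * y with hz
    have a1 : Commute γ (z ^ k * x * (z ^ k)⁻¹) :=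
        ((h2.pow_right k).mul_right h1).mul_right (h2.pow_right k).inv_right
    have : (x⁻¹ * xd x (z * x) k) ^ 2 = (x⁻¹ * (z ^ k * x * (z ^ k)⁻¹)) ^ 2 := by
      rw [h4, ← mul_assoc, ((h1.inv_right).mul_right a1).symm.mul_pow, h3, mul_one]
    rw [this]
    exact ⟨h.bz_x k hk, (h.hbz k hk).mul_right (h.bz_x k hk), by rw [← pow_mul]; exact h.hb k hk⟩

lemma Commute.xd_of {c d : G} (h1 : Commute c x) (h2 : Commute c d) (i : ℤ) : Commute c (xd x d i) :=
  ((h2.zpow_right i).mul_right h1).mul_right (h2.zpow_right i).inv_right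

lemma Rels.xd_comm_lt (h : Rels x y) (i : ℤ) (k : ℕ) (hk : 1 ≤ k) :
    xd x (y * x * y * x) i * xd x (y * x * y * x) (i + k) =
      xd x (y * x * y * x) (i + k) * xd x (y * x * y * x) i * cd x (y * x * y * x) k := by
  set d := y * x * y * x with hd
  have h1 := comm_sq (p := x) (q := xd x d k) rfl (conj_x2 h.comm_x2_d k)
  have h2 : cd x d k = (x⁻¹ * xd x d k) ^ 2 := by rw [cd, if_neg (by omega)]
  rw [← h2] at h1
  have h3 := ((h.cd_props k).2.1.zpow_right i).inv_right.eq
  rw [← hd] at h3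
  have e1 : xd x d (i + k) = d ^ i * xd x d k * (d ^ i)⁻¹ := by
    simp only [xd, _root_.zpow_add]; group
  rw [e1]
  calc xd x d i * (d ^ i * xd x d k * (d ^ i)⁻¹) = d ^ i * (x * xd x d k) * (d ^ i)⁻¹ := by
        simp only [xd]; group
    _ = d ^ i * xd x d k * x * (cd x d k * (d ^ i)⁻¹) := by rw [h1]; group
    _ = _ := by rw [h3]; simp only [xd]; group

lemma Rels.CC (h : Rels x y) (c : G) (hc : c ∈ Subgroup.closure (Set.range (cd x (y * x * y * x)))) :
    Commute c x ∧ Commute c (y * x * y * x) ∧ ∃ m, c = CL x (y * x * y * x) m := by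
  set d := y * x * y * x with hd
  have hlist : ∀ m : List ℕ, Commute (CL x d m) x ∧ Commute (CL x d m) d := by
    intro m
    induction m with
    | nil => simp [CL]
    | cons k m ih =>
      have := h.cd_props k
      simp only [CL, List.map_cons, List.prod_cons]
      exact ⟨this.1.mul_left ih.1, this.2.1.mul_left ih.2⟩
  have key : ∃ m, c = CL x d m := by
    induction hc using Subgroup.closure_induction_left with
    | one => exact ⟨[], by simp [CL]⟩
    | mul_left a ha b hb ih =>
      obtain ⟨k, rfl⟩ := ha
      obtain ⟨m, rfl⟩ := ih
      exact ⟨k :: m, by simp [CL]⟩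
    | inv_mul_cancel a ha b hb ih =>
      obtain ⟨k, rfl⟩ := ha
      obtain ⟨m, rfl⟩ := ih
      refine ⟨k :: m, ?_⟩
      have h2 := (h.cd_props k).2.2
      rw [pow_two, ← inv_eq_iff_mul_eq_one] at h2
      rw [← hd] at h2
      rw [h2]; simp [CL]
  obtain ⟨m, rfl⟩ := key
  exact ⟨(hlist m).1, (hlist m).2, m, rfl⟩

lemma CL_mem (x d : G) (m : List ℕ) : CL x d m ∈ Subgroup.closure (Set.range (cd x d)) := by
  apply Subgroup.list_prod_mem
  intro a ha
  obtain ⟨k, -, rfl⟩ := List.mem_map.1 ha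
  exact Subgroup.subset_closure ⟨k, rfl⟩

lemma Rels.XL_even (h : Rels x y) (l : List ℤ) (hl : ∀ i, Even (l.count i)) :
    ∃ m, XL x (y * x * y * x) l = CL x (y * x * y * x) m := by
  have := even_list (xd x (y * x * y * x)) (Subgroup.closure (Set.range (cd x (y * x * y * x))))
    (fun c hc i => (h.CC c hc).1.xd_of (h.CC c hc).2.1 i)
    (fun i => by
      rw [← pow_two, conj_x2 h.comm_x2_d]
      exact Subgroup.subset_closure ⟨0, by simp [cd]⟩)
    (fun i j => by
      rcases lt_trichotomy i j with hij | rfl | hij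
      · obtain ⟨k, rfl⟩ : ∃ k : ℕ, j = i + k := ⟨(j - i).toNat, by omega⟩
        exact ⟨_, Subgroup.subset_closure ⟨k, rfl⟩, h.xd_comm_lt i k (by omega)⟩
      · exact ⟨1, Subgroup.one_mem _, by simp⟩
      · obtain ⟨k, rfl⟩ : ∃ k : ℕ, i = j + k := ⟨(i - j).toNat, by omega⟩
        refine ⟨_, Subgroup.inv_mem _ (Subgroup.subset_closure ⟨k, rfl⟩), ?_⟩
        rw [h.xd_comm_lt j k (by omega)]; group)
    l.length l le_rfl hl
  exact (h.CC _ this).2.2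

lemma Rels.CL_even (h : Rels x y) (m : List ℕ) (hm : ∀ i, Even (m.count i)) :
    CL x (y * x * y * x) m = 1 := by
  have := even_list (cd x (y * x * y * x)) ⊥
    (fun c hc i => by rw [Subgroup.mem_bot] at hc; subst hc; simp)
    (fun i => by rw [← pow_two, (h.cd_props i).2.2]; simp)
    (fun i j => ⟨1, by simp, by
      rw [mul_one]
      have hj := h.CC (cd x (y * x * y * x) i) (Subgroup.subset_closure ⟨i, rfl⟩)
      have : Commute (cd x (y * x * y * x) i) (cd x (y * x * y * x) j) := by
        nth_rewrite 2 [cd]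
        split_ifs
        · exact hj.1.pow_right 2
        · exact (hj.1.inv_right.mul_right (hj.1.xd_of hj.2.1 _)).pow_right 2
      exact this.eq⟩)
    m.length m le_rfl hm
  simpa [CL] using this

lemma Rels.normal_form (h : Rels x y) (g : G)
    (hg : g ∈ Subgroup.closure {x, y * x * y * x}) :
    ∃ l m, ∃ k : ℤ, g = XL x (y * x * y * x) l * CL x (y * x * y * x) m * (y * x * y * x) ^ k := by
  set d := y * x * y * x with hd
  have hmulx : ∀ g : G, (∃ l m, ∃ k : ℤ, g = XL x d l * CL x d m * d ^ k) →
      ∃ l m, ∃ k : ℤ, g * x = XL x d l * CL x d m * d ^ k := by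
    rintro _ ⟨l, m, k, rfl⟩
    refine ⟨l ++ [k], m, k, ?_⟩
    have hc := h.CC _ (CL_mem x d m)
    have : XL x d (l ++ [k]) = XL x d l * xd x d k := by simp [XL]
    rw [this]
    have h2 := (hc.1.xd_of hc.2.1 k).eq
    rw [← hd] at h2
    calc _ = XL x d l * (CL x d m * xd x d k) * d ^ k := by simp only [xd]; group
      _ = _ := by rw [h2]; group
  induction hg using Subgroup.closure_induction_right with
  | one => exact ⟨[], [], 0, by simp [XL, CL]⟩
  | mul_right a ha b hb ih =>
    rcases hb with rfl | rfl
    · exact hmulx _ ih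
    · obtain ⟨l, m, k, rfl⟩ := ih
      exact ⟨l, m, k + 1, by rw [_root_.zpow_add_one]; group⟩
  | mul_inv_cancel a ha b hb ih =>
    rcases hb with rfl | rfl
    · have := hmulx _ (hmulx _ (hmulx _ ih))
      have hx : b⁻¹ = b * b * b := by
        rw [inv_eq_iff_mul_eq_one, ← h.hx]; simp only [pow_succ, pow_zero, one_mul, mul_assoc]
      rw [hx]
      simpa [mul_assoc] using this
    · obtain ⟨l, m, k, rfl⟩ := ih
      exact ⟨l, m, k - 1, by rw [_root_.zpow_sub_one]; group⟩

end GroupPart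

section Laurent

/-- support contained in `[l, h]` -/
def In (f : R2) (l h : ℤ) : Prop := ∀ n, (n < l ∨ h < n) → f.coeff n = 0

lemma In.mono {f : R2} {l h l' h' : ℤ} (hf : In f l h) (h1 : l' ≤ l) (h2 : h ≤ h') : In f l' h' :=
  fun n hn => hf n (by omega)

lemma In.add {f g : R2} {l h : ℤ} (hf : In f l h) (hg : In g l h) : In (f + g) l h := by
  intro n hn
  have h1 := hf n hn
  have h2 := hg n hn
  change f.coeff n + g.coeff n = 0
  rw [h1, h2, add_zero]

lemma coeff_add' (f g : R2) (n : ℤ) : (f + g).coeff n = f.coeff n + g.coeff n := rfl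

lemma coeff_Tmul (f : R2) (k n : ℤ) : (T k * f).coeff n = f.coeff (n - k) := by
  induction f using LaurentPolynomial.induction_on' with
  | add p q hp hq => rw [mul_add, coeff_add', coeff_add', hp, hq]
  | C_mul_T m a =>
    rw [mul_left_comm, ← T_add]
    simp only [← single_eq_C_mul_T, AddMonoidAlgebra.coeff_single]
    rw [Finsupp.single_apply, Finsupp.single_apply]
    congr 1
    apply propext
    constructor <;> intro h <;> omega

lemma In.Tmul {f : R2} {l h : ℤ} (k : ℤ) (hf : In f l h) : In (T k * f) (l + k) (h + k) := by
  intro n hn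
  rw [coeff_Tmul]
  exact hf _ (by omega)

lemma In_zero (l h : ℤ) : In 0 l h := fun _ _ => rfl

lemma In_T (k : ℤ) : In (T k) k k := by
  intro n hn
  rw [T_apply, if_neg (by omega)]

lemma z2 {a b : ZMod 2} (ha : a ≠ 0) (hb : b ≠ 0) : a + b = 0 := by
  revert a b; decide

/-- nonzero with exact support ends -/
structure Ex (f : R2) (l h : ℤ) : Prop where
  inn : In f l h
  lo : f.coeff l ≠ 0
  hi : f.coeff h ≠ 0

lemma Ex.le {f : R2} {l h : ℤ} (e : Ex f l h) : l ≤ h := by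
  by_contra hc
  exact e.lo (e.inn l (by omega))

lemma Ex.of_ne {f : R2} (hf : f ≠ 0) : ∃ l h, Ex f l h := by
  have hne : f.coeff.support.Nonempty := by
    rw [Finsupp.support_nonempty_iff]
    intro h
    apply hf
    ext n
    rw [h]; rfl
  refine ⟨f.coeff.support.min' hne, f.coeff.support.max' hne, ?_, ?_, ?_⟩
  · intro n hn
    by_contra hc
    have hm : n ∈ f.coeff.support := Finsupp.mem_support_iff.2 hc
    have h1 := Finset.min'_le _ n hm
    have h2 := Finset.le_max' _ n hm
    omega
  · exact Finsupp.mem_support_iff.1 (Finset.min'_mem _ hne)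
  · exact Finsupp.mem_support_iff.1 (Finset.max'_mem _ hne)

lemma Ex.ne {f : R2} {l h : ℤ} (e : Ex f l h) : f ≠ 0 := by
  rintro rfl
  exact e.lo rfl

lemma Ex.of_In {f : R2} {l h l' h' : ℤ} (e : Ex f l h) (i : In f l' h') : l' ≤ l ∧ h ≤ h' := by
  constructor
  · by_contra hc
    exact e.lo (i l (by omega))
  · by_contra hc
    exact e.hi (i h (by omega))

lemma Ex.uniq {f : R2} {l h l' h' : ℤ} (e : Ex f l h) (i : Ex f l' h') : l = l' ∧ h = h' := by
  have := e.of_In i.inn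
  have := i.of_In e.inn
  omega

lemma Ex.Tmul {f : R2} {l h : ℤ} (k : ℤ) (hf : Ex f l h) : Ex (T k * f) (l + k) (h + k) :=
  ⟨hf.inn.Tmul k, by rw [coeff_Tmul, add_sub_cancel_right]; exact hf.lo,
    by rw [coeff_Tmul, add_sub_cancel_right]; exact hf.hi⟩

lemma Ex_T (k : ℤ) : Ex (T k) k k := ⟨In_T k, by rw [T_apply]; simp, by rw [T_apply]; simp⟩

lemma mul_top {f g : R2} {l h l' h' : ℤ} (hf : In f l h) (hg : In g l' h') :
    In (f * g) (l + l') (h + h') ∧ (f * g).coeff (l + l') = f.coeff l * g.coeff l' ∧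
    (f * g).coeff (h + h') = f.coeff h * g.coeff h' := by
  have key : ∀ n, (f * g).coeff n =
      ∑ i ∈ f.coeff.support, f.coeff i * g.coeff (n - i) := by
    intro n
    rw [AddMonoidAlgebra.coeff_mul, Finsupp.sum]
    apply Finset.sum_congr rfl
    intro i _
    rw [Finsupp.sum, Finset.sum_eq_single (n - i)]
    · rw [if_pos (by omega)]
    · intro j _ hj
      rw [if_neg (by omega)]
    · intro hl
      rw [Finsupp.notMem_support_iff.1 hl]
      simp
  refine ⟨?_, ?_, ?_⟩
  · intro n hn
    rw [key]
    apply Finset.sum_eq_zero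
    intro i hi
    by_cases hc : i < l ∨ h < i
    · rw [hf i hc, zero_mul]
    · rw [hg (n - i) (by omega), mul_zero]
  · rw [key, Finset.sum_eq_single l]
    · congr 2; omega
    · intro i hi hil
      by_cases hc : i < l ∨ h < i
      · rw [hf i hc, zero_mul]
      · rw [hg _ (by omega), mul_zero]
    · intro hl
      rw [Finsupp.notMem_support_iff.1 hl, zero_mul]
  · rw [key, Finset.sum_eq_single h]
    · congr 2; omega
    · intro i hi hil
      by_cases hc : i < l ∨ h < i
      · rw [hf i hc, zero_mul]
      · rw [hg _ (by omega), mul_zero]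
    · intro hl
      rw [Finsupp.notMem_support_iff.1 hl, zero_mul]

lemma Ex.mul {f g : R2} {l h l' h' : ℤ} (hf : Ex f l h) (hg : Ex g l' h') :
    Ex (f * g) (l + l') (h + h') := by
  obtain ⟨h1, h2, h3⟩ := mul_top hf.inn hg.inn
  exact ⟨h1, by rw [h2]; exact mul_ne_zero hf.lo hg.lo, by rw [h3]; exact mul_ne_zero hf.hi hg.hi⟩

lemma In.mul {f g : R2} {l h l' h' : ℤ} (hf : In f l h) (hg : In g l' h') :
    In (f * g) (l + l') (h + h') := (mul_top hf hg).1

lemma In.inv {f : R2} {l h : ℤ} (hf : In f l h) : In (invert f) (-h) (-l) := by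
  intro n hn
  rw [invert_apply]
  exact hf _ (by omega)

lemma Ex.inv {f : R2} {l h : ℤ} (hf : Ex f l h) : Ex (invert f) (-h) (-l) :=
  ⟨hf.inn.inv, by rw [invert_apply, neg_neg]; exact hf.hi,
    by rw [invert_apply, neg_neg]; exact hf.lo⟩

/-- adding something strictly inside at the top -/
lemma Ex_one_add : Ex (1 + T 1) 0 1 := by
  have h1 : Ex (1 : R2) 0 0 := by rw [← T_zero]; exact Ex_T 0
  refine ⟨(h1.inn.mono (by omega) (by omega)).add ((In_T 1).mono (by omega) (by omega)), ?_, ?_⟩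
  · rw [coeff_add', (In_T 1) 0 (by omega), add_zero]; exact h1.lo
  · rw [coeff_add', h1.inn 1 (by omega), zero_add]; exact (Ex_T 1).lo

end Laurent

section Frames

lemma two0 : (2 : R2) = 0 := by
  have := CharP.cast_eq_zero R2 2
  exact_mod_cast this

lemma tti : (T 1 : R2) * T (-1) = 1 := by rw [← T_add]; simp

lemma dbl (a : R2) : a + a = 0 := CharTwo.add_self_eq_zero a

def Xg : GL (Fin 3) R2 :=
  ⟨!![1, T 1, 1; 0, 1, 0; 0, 1 + T 1, 1], !![1, 1, 1; 0, 1, 0; 0, 1 + T 1, 1], by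
    rw [Matrix.mul_fin_three, Matrix.one_fin_three]
    congr! <;> grind [two0], by
    rw [Matrix.mul_fin_three, Matrix.one_fin_three]
    congr! <;> grind [two0]⟩

def Tg : GL (Fin 3) R2 :=
  ⟨!![0, T 1, 0; 1, 0, 0; 0, 0, 1], !![0, 1, 0; T (-1), 0, 0; 0, 0, 1], by
    rw [Matrix.mul_fin_three, Matrix.one_fin_three]
    congr! <;> grind [tti], by
    rw [Matrix.mul_fin_three, Matrix.one_fin_three]
    congr! <;> grind [tti]⟩

/-- the auxiliary representation -/
def P : FreeGroup (Fin 2) →* GL (Fin 3) R2 := FreeGroup.lift ![Xg, Tg * Xg⁻¹]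

lemma P_x : P fx = Xg := by simp [P, fx]
lemma P_y : P fy = Tg * Xg⁻¹ := by simp [P, fy]

def fa (w : FreeGroup (Fin 2)) (i : Fin 3) : R2 := (P w).val i 0
def fb (w : FreeGroup (Fin 2)) (i : Fin 3) : R2 := (P w).val i 1
def fz (w : FreeGroup (Fin 2)) (i : Fin 3) : R2 := (P w).val i 2

def ft : FreeGroup (Fin 2) := fy * fx
def fd : FreeGroup (Fin 2) := fy * fx * fy * fx

lemma P_t : P ft = Tg := by rw [ft, map_mul, P_x, P_y]; group

lemma fa_x (v i) : fa (v * fx) i = fa v i := by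
  simp only [fa, map_mul, P_x, Units.val_mul, Matrix.mul_apply, Fin.sum_univ_three]
  simp [Xg]
lemma fb_x (v i) : fb (v * fx) i = fb v i + T 1 * fa v i + (1 + T 1) * fz v i := by
  simp only [fa, fb, fz, map_mul, P_x, Units.val_mul, Matrix.mul_apply, Fin.sum_univ_three]
  simp [Xg]; ring
lemma fz_x (v i) : fz (v * fx) i = fz v i + fa v i := by
  simp only [fa, fb, fz, map_mul, P_x, Units.val_mul, Matrix.mul_apply, Fin.sum_univ_three]
  simp [Xg]; ring

lemma fa_t (v i) : fa (v * ft) i = fb v i := by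
  simp only [fa, fb, fz, map_mul, P_t, Units.val_mul, Matrix.mul_apply, Fin.sum_univ_three]
  simp [Tg]
lemma fb_t (v i) : fb (v * ft) i = T 1 * fa v i := by
  simp only [fa, fb, fz, map_mul, P_t, Units.val_mul, Matrix.mul_apply, Fin.sum_univ_three]
  simp [Tg]
lemma fz_t (v i) : fz (v * ft) i = fz v i := by
  simp only [fa, fb, fz, map_mul, P_t, Units.val_mul, Matrix.mul_apply, Fin.sum_univ_three]
  simp [Tg]

lemma fa_xi (v i) : fa (v * fx⁻¹) i = fa v i := by
  have := fa_x (v * fx⁻¹) i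
  rw [inv_mul_cancel_right] at this
  exact this.symm
lemma fz_xi (v i) : fz (v * fx⁻¹) i = fz v i + fa v i := by
  have := fz_x (v * fx⁻¹) i
  rw [inv_mul_cancel_right, fa_xi] at this
  grind [two0]
lemma fb_xi (v i) : fb (v * fx⁻¹) i = fb v i + fa v i + (1 + T 1) * fz v i := by
  have := fb_x (v * fx⁻¹) i
  rw [inv_mul_cancel_right, fa_xi, fz_xi] at this
  grind [two0]

lemma ft2 : ft * ft = fd := by simp only [ft, fd, mul_assoc]

lemma fa_d (v i) : fa (v * fd) i = T 1 * fa v i := by rw [← ft2, ← mul_assoc, fa_t, fb_t]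
lemma fb_d (v i) : fb (v * fd) i = T 1 * fb v i := by rw [← ft2, ← mul_assoc, fb_t, fa_t]
lemma fz_d (v i) : fz (v * fd) i = fz v i := by rw [← ft2, ← mul_assoc, fz_t, fz_t]

lemma f_dz (k : ℤ) : ∀ v i, fa (v * fd ^ k) i = T k * fa v i ∧ fb (v * fd ^ k) i = T k * fb v i ∧
    fz (v * fd ^ k) i = fz v i := by
  induction k with
  | zero => intro v i; simp
  | succ k ih =>
    intro v i
    rw [_root_.zpow_add_one, ← mul_assoc, fa_d, fb_d, fz_d, (ih v i).1, (ih v i).2.1, (ih v i).2.2,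
      ← mul_assoc, ← mul_assoc, ← T_add, add_comm (1:ℤ)]
    simp
  | pred k ih =>
    intro v i
    have h1 := fa_d (v * fd ^ (-(k:ℤ) - 1)) i
    have h2 := fb_d (v * fd ^ (-(k:ℤ) - 1)) i
    have h3 := fz_d (v * fd ^ (-(k:ℤ) - 1)) i
    have h0 : v * fd ^ (-(k:ℤ) - 1) * fd = v * fd ^ (-(k:ℤ)) := by
      rw [mul_assoc, ← _root_.zpow_add_one, sub_add_cancel]
    rw [h0, (ih v i).1] at h1
    rw [h0, (ih v i).2.1] at h2
    rw [h0, (ih v i).2.2] at h3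
    have h4 : (T (-(k:ℤ) - 1) : R2) = T (-1) * T (-(k:ℤ)) := by rw [← T_add]; congr 1; ring
    refine ⟨?_, ?_, h3.symm⟩
    · rw [h4, mul_assoc, h1, ← mul_assoc, mul_comm (T (-1)), tti, one_mul]
    · rw [h4, mul_assoc, h2, ← mul_assoc, mul_comm (T (-1)), tti, one_mul]

lemma P_ext {u v : FreeGroup (Fin 2)} (h1 : ∀ i, fa u i = fa v i) (h2 : ∀ i, fb u i = fb v i)
    (h3 : ∀ i, fz u i = fz v i) : P u = P v := by
  apply Units.ext
  ext1 i j
  fin_cases j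
  · exact h1 i
  · exact h2 i
  · exact h3 i

lemma f_one : (fa 1 0 = 1 ∧ fa 1 1 = 0 ∧ fa 1 2 = 0) ∧ (fb 1 0 = 0 ∧ fb 1 1 = 1 ∧ fb 1 2 = 0) ∧
    (fz 1 0 = 0 ∧ fz 1 1 = 0 ∧ fz 1 2 = 1) := by
  simp [fa, fb, fz]

/-- the invariant form on rows -/
def qf (w : FreeGroup (Fin 2)) : R2 :=
  T 1 * fa w 1 * invert (fb w 1) + invert (fa w 1) * fb w 1 + (1 + T 1) * fz w 1 * invert (fz w 1)

lemma inv_T1 : (invert (T 1 : R2)) = T (-1) := by rw [invert_T]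

lemma qf_x (v) : qf (v * fx) = qf v := by
  simp only [qf, fa_x, fb_x, fz_x, map_add, map_mul, map_one, inv_T1]
  grind [two0, tti]

lemma qf_t (v) : qf (v * ft) = qf v := by
  simp only [qf, fa_t, fb_t, fz_t, map_add, map_mul, map_one, inv_T1]
  grind [two0, tti]

/-- generic induction: property of words preserved under x and t -/
lemma word_ind (C : FreeGroup (Fin 2) → Prop) (h1 : C 1) (hx : C fx) (ht : C ft)
    (hi : ∀ w, C w → C w⁻¹) (hm : ∀ v w, C v → C w → C (v * w)) (w) : C w := by
  have hy : C fy := by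
    have : fy = ft * fx⁻¹ := by rw [ft]; group
    rw [this]
    exact hm _ _ ht (hi _ hx)
  induction w using FreeGroup.induction_on with
  | C1 => exact h1
  | of i => fin_cases i; exacts [hx, hy]
  | inv_of i h => exact hi _ h
  | mul v w hv hw => exact hm _ _ hv hw

lemma qf_inv (w) : ∀ v, qf (v * w) = qf v := by
  refine word_ind (fun w => ∀ v, qf (v * w) = qf v) ?_ qf_x qf_t ?_ ?_ w
  · intro v; rw [mul_one]
  · intro w hw v
    have := hw (v * w⁻¹)
    rw [inv_mul_cancel_right] at this
    exact this.symm
  · intro v w hv hw u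
    rw [← mul_assoc, hw, hv]

lemma isotropic (w) : T 1 * fa w 1 * invert (fb w 1) + invert (fa w 1) * fb w 1 =
    (1 + T 1) * (fz w 1 * invert (fz w 1)) := by
  have := qf_inv w 1
  rw [one_mul] at this
  have h0 : qf 1 = 0 := by
    rw [qf, f_one.1.2.1, f_one.2.2.2.1]; simp
  rw [h0, qf] at this
  grind [two0]

lemma row_ne (w) (ha : fa w 1 = 0) (hb : fb w 1 = 0) : False := by
  have h := isotropic w
  rw [ha, hb] at h
  simp only [map_zero, mul_zero, add_zero] at h
  have hz : fz w 1 = 0 := by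
    by_contra hz
    obtain ⟨l, u, e⟩ := Ex.of_ne hz
    exact (Ex_one_add.mul (e.mul e.inv)).ne h.symm
  have hd : (P w).val.det = 0 := by
    apply Matrix.det_eq_zero_of_row_eq_zero 1
    intro j
    fin_cases j
    · exact ha
    · exact hb
    · exact hz
  have : IsUnit (P w).val.det := (Matrix.isUnit_iff_isUnit_det _).1 (P w).isUnit
  rw [hd] at this
  exact not_isUnit_zero this

/-- unipotent type elements -/
def U (u : FreeGroup (Fin 2)) (p w : R2) : Prop := ∀ v i, fa (v * u) i = fa v i ∧
  fb (v * u) i = fb v i + w * fa v i + (1 + T 1) * invert p * fz v i ∧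
  fz (v * u) i = fz v i + p * fa v i

lemma U_one : U 1 0 0 := by intro v i; simp

lemma U_x : U fx 1 (T 1) := by
  intro v i; rw [fa_x, fb_x, fz_x]; simp

lemma U.mul {u u' p p' w w'} (h : U u p w) (h' : U u' p' w') :
    U (u * u') (p + p') (w + w' + (1 + T 1) * invert p' * p) := by
  intro v i
  obtain ⟨h1, h2, h3⟩ := h v i
  obtain ⟨h4, h5, h6⟩ := h' (v * u) i
  rw [← mul_assoc, h4, h5, h6, h1, h2, h3, map_add]
  refine ⟨rfl, ?_, ?_⟩ <;> ring

lemma U.inv {u p w} (h : U u p w) : U u⁻¹ p (w + (1 + T 1) * invert p * p) := by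
  intro v i
  obtain ⟨h1, h2, h3⟩ := h (v * u⁻¹) i
  rw [inv_mul_cancel_right] at h1 h2 h3
  have e3 : fz (v * u⁻¹) i = fz v i + p * fa v i := by rw [h3, h1]; grind [two0]
  refine ⟨h1.symm, ?_, e3⟩
  rw [e3, ← h1] at h2
  grind [two0]

lemma U.conj_d {u p w} (h : U u p w) (k : ℤ) : U (fd ^ k * u * (fd ^ k)⁻¹) (T k * p) w := by
  intro v i
  obtain ⟨d1, d2, d3⟩ := f_dz k v i
  obtain ⟨h1, h2, h3⟩ := h (v * fd ^ k) i
  obtain ⟨e1, e2, e3⟩ := f_dz (-k) (v * fd ^ k * u) i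
  have hk : (T (-k) : R2) * T k = 1 := by rw [← T_add]; simp
  have e : v * (fd ^ k * u * (fd ^ k)⁻¹) = v * fd ^ k * u * fd ^ (-k) := by rw [_root_.zpow_neg]; group
  rw [e, e1, e2, e3, h1, h2, h3, d1, d2, d3, map_mul, invert_T]
  refine ⟨?_, ?_, ?_⟩ <;> grind

lemma U.P_eq_one {u} (h : U u 0 0) : P u = 1 := by
  rw [← map_one P]
  apply P_ext <;> intro i <;> have := h 1 i <;> simp_all

end Frames

section Rel

local notation "F2" => FreeGroup (Fin 2)

def NN : Subgroup (FreeGroup (Fin 2)) := Subgroup.normalClosure q42RelsC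

instance : NN.Normal := by unfold NN; infer_instance

def KK : Subgroup (FreeGroup (Fin 2)) := (Subgroup.center (GL (Fin 3) R2)).comap P

instance : KK.Normal := by unfold KK; infer_instance

lemma center_iff (g : GL (Fin 3) R2) : g ∈ Subgroup.center (GL (Fin 3) R2) ↔
    ∃ s : R2, ∀ i j, g.val i j = if i = j then s else 0 := by
  rw [Matrix.GeneralLinearGroup.mem_center_iff_val_mem_range_scalar]
  constructor
  · rintro ⟨s, hs⟩
    refine ⟨s, fun i j => ?_⟩
    rw [← hs, Matrix.scalar_apply, Matrix.diagonal_apply]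
  · rintro ⟨s, hs⟩
    refine ⟨s, ?_⟩
    ext1 i j
    rw [hs, Matrix.scalar_apply, Matrix.diagonal_apply]

lemma unit_T {s s' : R2} (h : s * s' = 1) : ∃ k, s = T k := by
  have h1 : s ≠ 0 := by rintro rfl; simp at h
  have h2 : s' ≠ 0 := by rintro rfl; simp at h
  obtain ⟨l, u, e⟩ := Ex.of_ne h1
  obtain ⟨l', u', e'⟩ := Ex.of_ne h2
  have e2 := e.mul e'
  rw [h, ← T_zero] at e2
  have h3 := e2.uniq (Ex_T 0)
  have h4 := e.le
  have h5 := e'.le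
  have h6 : l = u := by omega
  subst h6
  refine ⟨l, ?_⟩
  ext n
  by_cases hn : n = l
  · subst hn
    have h7 := e.lo
    have h8 := (Ex_T n).lo
    generalize s.coeff n = a at *
    generalize (T n : R2).coeff n = b at *
    revert a b; decide
  · rw [e.inn n (by omega), In_T l n (by omega)]

lemma KK_scal {n} (hn : n ∈ KK) : ∃ k : ℤ, ∀ v i, fa (v * n) i = T k * fa v i ∧
    fb (v * n) i = T k * fb v i ∧ fz (v * n) i = T k * fz v i := by
  obtain ⟨s, hs⟩ := (center_iff _).1 hn
  obtain ⟨s', hs'⟩ := (center_iff _).1 (KK.inv_mem hn)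
  have h1 : s * s' = 1 := by
    have : (P n).val * (P n⁻¹).val = 1 := by
      rw [← Units.val_mul, ← map_mul]; simp
    have := congrFun (congrFun this 0) 0
    rw [Matrix.mul_apply, Fin.sum_univ_three, hs, hs, hs, hs', hs', hs'] at this
    simpa using this
  obtain ⟨k, rfl⟩ := unit_T h1
  refine ⟨k, fun v i => ?_⟩
  simp only [fa, fb, fz, map_mul, Units.val_mul, Matrix.mul_apply, Fin.sum_univ_three, hs]
  simp

lemma KK_of_P {w} (h : P w = 1) : w ∈ KK := by
  change P w ∈ Subgroup.center (GL (Fin 3) R2)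
  rw [h]; exact Subgroup.one_mem _

lemma U.sq {u p w} (h : U u p w) : U (u ^ 2) 0 ((1 + T 1) * invert p * p) := by
  have := h.mul h
  rw [dbl, dbl, zero_add] at this
  rwa [pow_two]

lemma U.four {u p w} (h : U u p w) : P (u ^ 4) = 1 := by
  apply U.P_eq_one
  have := h.sq.sq
  rw [← pow_mul] at this
  simpa using this

lemma z_eq : fy * fx * fy = fd * fx⁻¹ := by rw [fd]; group

lemma U.comm_z {u w} (h : U u 0 w) : P (br u (fy * fx * fy)) = 1 := by
  have e : br u (fy * fx * fy) = (fy * fx * fy * u)⁻¹ * (u * (fy * fx * fy)) := by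
    rw [br]; group
  rw [e, map_mul, map_inv, inv_mul_eq_one, z_eq]
  apply P_ext <;> intro i
  all_goals
    obtain ⟨h1, h2, h3⟩ := h 1 i
    obtain ⟨h4, h5, h6⟩ := h (fd * fx⁻¹) i
    obtain ⟨k1, k2, k3⟩ := And.intro (fa_d 1 i) (And.intro (fb_d 1 i) (fz_d 1 i))
    rw [one_mul] at h1 h2 h3 k1 k2 k3
  · rw [h4, ← mul_assoc, fa_xi, fa_xi, fa_d, k1, h1]
  · rw [h5, ← mul_assoc, fb_xi, fb_xi, fz_xi, fa_xi, fa_d, fb_d, fz_d, k1, k2, k3, h1, h2, h3]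
    simp; ring
  · rw [h6, ← mul_assoc, fz_xi, fz_xi, fa_xi, fa_d, fz_d, k1, k3, h1, h3]
    simp

lemma U.conj_z {u} (h : ∃ p w, U u p w) (i : ℕ) :
    ∃ p w, U ((fy * fx * fy) ^ i * u * ((fy * fx * fy) ^ i)⁻¹) p w := by
  induction i with
  | zero => simpa using h
  | succ i ih =>
    obtain ⟨p, w, h⟩ := ih
    have e : (fy * fx * fy) ^ (i + 1) * u * ((fy * fx * fy) ^ (i + 1))⁻¹ =
        fd ^ (1:ℤ) * (fx⁻¹ * ((fy * fx * fy) ^ i * u * ((fy * fx * fy) ^ i)⁻¹) * fx) *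
          (fd ^ (1:ℤ))⁻¹ := by
      rw [pow_succ']
      generalize (fy * fx * fy) ^ i = a
      rw [z_eq]; group
    rw [e]
    exact ⟨_, _, ((U_x.inv.mul h).mul U_x).conj_d 1⟩

lemma bwd_eq (i : ℕ) :
    bwd i = fx⁻¹ * ((fy * fx * fy) ^ i * fx * ((fy * fx * fy) ^ i)⁻¹) := by
  rw [bwd, br, _root_.zpow_neg, zpow_natCast]
  generalize (fy * fx * fy) ^ i = a
  group

lemma U_bwd (i : ℕ) : ∃ p w, U (bwd i) p w := by
  obtain ⟨p, w, h⟩ := U.conj_z ⟨_, _, U_x⟩ i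
  rw [bwd_eq]
  exact ⟨_, _, U_x.inv.mul h⟩

lemma y3_mem : fy ^ 3 ∈ KK := by
  have hy : fy = ft * fx⁻¹ := by rw [ft]; group
  have ha : ∀ v i, fa (v * fy) i = fb v i := by
    intro v i; rw [hy, ← mul_assoc, fa_xi, fa_t]
  have hb : ∀ v i, fb (v * fy) i = T 1 * fa v i + fb v i + (1 + T 1) * fz v i := by
    intro v i; rw [hy, ← mul_assoc, fb_xi, fa_t, fb_t, fz_t]
  have hz : ∀ v i, fz (v * fy) i = fz v i + fb v i := by
    intro v i; rw [hy, ← mul_assoc, fz_xi, fa_t, fz_t]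
  have e : fy ^ 3 = 1 * fy * fy * fy := by rw [one_mul, pow_succ, pow_two]
  have h1 : ∀ i, fa (fy ^ 3) i = T 1 * fa 1 i := by
    intro i; rw [e]; simp only [ha, hb, hz]; grind [two0]
  have h2 : ∀ i, fb (fy ^ 3) i = T 1 * fb 1 i := by
    intro i; rw [e]; simp only [ha, hb, hz]; grind [two0]
  have h3 : ∀ i, fz (fy ^ 3) i = T 1 * fz 1 i := by
    intro i; rw [e]; simp only [ha, hb, hz]; grind [two0]
  obtain ⟨⟨a1, a2, a3⟩, ⟨b1, b2, b3⟩, ⟨c1, c2, c3⟩⟩ := f_one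
  refine (center_iff _).2 ⟨T 1, fun i j => ?_⟩
  fin_cases j
  · refine (h1 i).trans ?_
    fin_cases i <;> simp [a1, a2, a3]
  · refine (h2 i).trans ?_
    fin_cases i <;> simp [b1, b2, b3]
  · refine (h3 i).trans ?_
    fin_cases i <;> simp [c1, c2, c3]

lemma NN_le : NN ≤ KK := by
  apply Subgroup.normalClosure_le_normal
  rintro r ((h | ⟨i, hi, rfl⟩) | ⟨i, hi, rfl⟩)
  · rcases h with rfl | rfl | rfl
    · exact y3_mem
    · exact KK_of_P U_x.four
    · exact KK_of_P U_x.sq.comm_z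
  · obtain ⟨p, w, h⟩ := U_bwd i
    exact KK_of_P h.four
  · obtain ⟨p, w, h⟩ := U_bwd i
    exact KK_of_P h.sq.comm_z

def pq : FreeGroup (Fin 2) →* FreeGroup (Fin 2) ⧸ NN := QuotientGroup.mk' NN

lemma pq_one {w} : pq w = 1 ↔ w ∈ NN := QuotientGroup.eq_one_iff w

lemma pq_eq {v w} : pq v = pq w ↔ v⁻¹ * w ∈ NN := QuotientGroup.eq

lemma br_comm {G : Type*} [Group G] {a b : G} (h : br a b = 1) : Commute a b := by
  rw [br] at h
  change a * b = b * a
  have : a * b = b * a * (a⁻¹ * b⁻¹ * a * b) := by group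
  rw [this, h, mul_one]

lemma map_br {G K : Type*} [Group G] [Group K] (f : G →* K) (a b : G) :
    f (br a b) = br (f a) (f b) := by simp [br]

lemma rels : Rels (pq fx) (pq fy) := by
  have hs : ∀ r ∈ q42RelsC, pq r = 1 := fun r hr => pq_one.2 (Subgroup.subset_normalClosure hr)
  constructor
  · rw [← map_pow]; exact hs _ (by simp [q42RelsC])
  · rw [← map_pow]; exact hs _ (by simp [q42RelsC])
  · have := hs (br (fx ^ 2) (fy * fx * fy)) (by simp [q42RelsC])
    rw [map_br] at this
    simpa using br_comm this
  · intro i hi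
    have := hs (bwd i ^ 4) (Or.inl (Or.inr ⟨i, hi, rfl⟩))
    rw [bwd_eq] at this
    simpa using this
  · intro i hi
    have := hs (br (bwd i ^ 2) (fy * fx * fy)) (Or.inr ⟨i, hi, rfl⟩)
    rw [map_br, bwd_eq] at this
    simpa using br_comm this

end Rel

section HPart

def HH : Subgroup (FreeGroup (Fin 2)) := Subgroup.closure {fx, fd}

def HF : Subgroup (FreeGroup (Fin 2)) := (HH.map pq).comap pq

lemma HF_iff {h} : h ∈ HF ↔ ∃ h0 ∈ HH, h0⁻¹ * h ∈ NN := by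
  rw [HF, Subgroup.mem_comap, Subgroup.mem_map]
  simp only [pq_eq]

lemma HH_le : HH ≤ HF := fun h hh => HF_iff.2 ⟨h, hh, by simp⟩
lemma NN_le_HF : NN ≤ HF := fun h hh => HF_iff.2 ⟨1, HH.one_mem, by simpa using hh⟩
lemma fx_HH : fx ∈ HH := Subgroup.subset_closure (by simp)
lemma fd_HH : fd ∈ HH := Subgroup.subset_closure (by simp)

lemma HH_form {h} (hh : h ∈ HH) : ∃ u p w, ∃ k : ℤ, U u p w ∧ h = u * fd ^ k := by
  induction hh using Subgroup.closure_induction_right with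
  | one => exact ⟨1, 0, 0, 0, U_one, by simp⟩
  | mul_right a ha b hb ih =>
    obtain ⟨u, p, w, k, hu, rfl⟩ := ih
    rcases hb with rfl | rfl
    · exact ⟨_, _, _, k, hu.mul (U_x.conj_d k), by group⟩
    · exact ⟨u, p, w, k + 1, hu, by rw [_root_.zpow_add_one, mul_assoc]⟩
  | mul_inv_cancel a ha b hb ih =>
    obtain ⟨u, p, w, k, hu, rfl⟩ := ih
    rcases hb with rfl | rfl
    · exact ⟨_, _, _, k, hu.mul (U_x.inv.conj_d k), by group⟩
    · exact ⟨u, p, w, k - 1, hu, by rw [_root_.zpow_sub_one, mul_assoc]⟩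

def pl (l : List ℤ) : R2 := (l.map (fun i => (T i : R2))).sum

def ek (k : ℕ) : R2 := if k = 0 then 1 else T k + T (-k)

def fl (m : List ℕ) : R2 := (m.map ek).sum

lemma pl_coeff (l : List ℤ) (i : ℤ) : (pl l).coeff i = (l.count i : ZMod 2) := by
  induction l with
  | nil => simp [pl]
  | cons j l ih =>
    have : pl (j :: l) = T j + pl l := by simp [pl]
    rw [this, coeff_add', ih, T_apply, List.count_cons]
    by_cases h : j = i
    · simp [h, add_comm]
    · simp [h]

lemma ek_coeff (j k : ℕ) : (ek j).coeff (k : ℤ) = if j = k then 1 else 0 := by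
  rw [ek]
  split_ifs with h1 h2 h2
  · rw [← T_zero, T_apply, if_pos (by omega)]
  · rw [← T_zero, T_apply, if_neg (by omega)]
  · rw [coeff_add', T_apply, T_apply, if_pos (by omega), if_neg (by omega), add_zero]
  · rw [coeff_add', T_apply, T_apply, if_neg (by omega), if_neg (by omega), add_zero]

lemma fl_coeff (l : List ℕ) (i : ℕ) : (fl l).coeff (i : ℤ) = (l.count i : ZMod 2) := by
  induction l with
  | nil => simp [fl]
  | cons j l ih =>
    have : fl (j :: l) = ek j + fl l := by simp [fl]
    rw [this, coeff_add', ih, ek_coeff, List.count_cons]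
    by_cases h : j = i
    · simp [h, add_comm]
    · simp [h]

lemma even_of {n : ℕ} (h : (n : ZMod 2) = 0) : Even n := by
  rw [ZMod.natCast_eq_zero_iff] at h
  exact even_iff_two_dvd.2 h

lemma U_xd (i : ℤ) : U (xd fx fd i) (T i) (T 1) := by
  have := U_x.conj_d i
  rwa [mul_one] at this

lemma U_XL (l : List ℤ) : ∃ w, U (XL fx fd l) (pl l) w := by
  induction l with
  | nil => exact ⟨0, by simpa [XL, pl] using U_one⟩
  | cons j l ih =>
    obtain ⟨w, h⟩ := ih
    have := (U_xd j).mul h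
    exact ⟨_, by simpa [XL, pl] using this⟩

lemma U_cd (k : ℕ) : U (cd fx fd k) 0 ((1 + T 1) * ek k) := by
  rw [cd, ek]
  split_ifs with h
  · simpa using U_x.sq
  · have := (U_x.inv.mul (U_xd k)).sq
    have e : (1 + T 1) * invert (1 + T (k:ℤ)) * (1 + T (k:ℤ)) = (1 + T 1) * (T k + T (-k) : R2) := by
      rw [map_add, map_one, invert_T]
      have : (T (-k) * T k : R2) = 1 := by rw [← T_add]; simp
      grind [two0]
    rwa [e] at this

lemma U_CL (m : List ℕ) : U (CL fx fd m) 0 ((1 + T 1) * fl m) := by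
  induction m with
  | nil => simpa [CL, fl] using U_one
  | cons j l ih =>
    have := (U_cd j).mul ih
    simpa [CL, fl, mul_add] using this

lemma pq_fd : pq fd = pq fy * pq fx * pq fy * pq fx := by simp [fd]

lemma pq_xd (i) : pq (xd fx fd i) = xd (pq fx) (pq fd) i := by
  simp [xd]

lemma pq_cd (i) : pq (cd fx fd i) = cd (pq fx) (pq fd) i := by
  rw [cd, cd]; split_ifs
  · simp
  · rw [map_pow, map_mul, map_inv, pq_xd]

lemma pq_XL (l) : pq (XL fx fd l) = XL (pq fx) (pq fd) l := by
  rw [XL, XL, map_list_prod, List.map_map]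
  exact congrArg List.prod (List.map_congr_left fun i _ => pq_xd i)

lemma pq_CL (l) : pq (CL fx fd l) = CL (pq fx) (pq fd) l := by
  rw [CL, CL, map_list_prod, List.map_map]
  exact congrArg List.prod (List.map_congr_left fun i _ => pq_cd i)

lemma U.uniq {u u' p p' w w'} (h : U u p w) (h' : U u' p' w') (e : u⁻¹ * u' ∈ KK) :
    p = p' ∧ w = w' := by
  obtain ⟨k, hk⟩ := KK_scal e
  obtain ⟨⟨a1, a2, a3⟩, ⟨b1, b2, b3⟩, ⟨c1, c2, c3⟩⟩ := f_one
  have e1 : u * (u⁻¹ * u') = u' := by group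
  have hh := fun i => hk u i
  rw [e1] at hh
  have k1 := fun i => h 1 i
  have k2 := fun i => h' 1 i
  simp only [one_mul] at k1 k2
  have t1 : (T k : R2) = 1 := by
    have := (hh 0).1
    rw [(k1 0).1, (k2 0).1, a1, mul_one] at this
    exact this.symm
  have t2 := (hh 0).2.1
  have t3 := (hh 0).2.2
  rw [t1, (k1 0).2.1, (k2 0).2.1, a1, b1, c1] at t2
  rw [t1, (k1 0).2.2, (k2 0).2.2, a1, c1] at t3
  simp at t2 t3
  exact ⟨t3.symm, t2.symm⟩

/-- the key structure result for unipotent elements -/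
lemma U_NF {h w} (hh : h ∈ HH) (hu : U h 0 w) : ∃ f, w = (1 + T 1) * f ∧ (f = 0 → h ∈ NN) := by
  have h1 : pq h ∈ Subgroup.closure {pq fx, pq fy * pq fx * pq fy * pq fx} := by
    rw [← pq_fd, show ({pq fx, pq fd} : Set _) = pq '' {fx, fd} by simp [Set.image_pair],
      ← MonoidHom.map_closure]
    exact Subgroup.mem_map_of_mem _ hh
  obtain ⟨l, m, k, e⟩ := rels.normal_form _ h1
  rw [← pq_fd, ← pq_XL, ← pq_CL, ← map_zpow, ← map_mul, ← map_mul, pq_eq] at e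
  have e' := NN_le e
  obtain ⟨w1, hl⟩ := U_XL l
  have hc := hl.mul (U_CL m)
  -- k = 0
  have hk : k = 0 := by
    obtain ⟨j, hj⟩ := KK_scal e'
    obtain ⟨⟨a1, a2, a3⟩, ⟨b1, b2, b3⟩, ⟨c1, c2, c3⟩⟩ := f_one
    have e1 : h * (h⁻¹ * (XL fx fd l * CL fx fd m * fd ^ k)) =
      XL fx fd l * CL fx fd m * fd ^ k := by group
    have hh := fun i => hj h i
    rw [e1] at hh
    have k1 := fun i => hu 1 i
    have k2 := fun i => hc 1 i
    simp only [one_mul] at k1 k2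
    have q1 := (hh 0).1
    have q2 := (hh 2).2.2
    rw [(f_dz k _ _).1, (k1 0).1, (k2 0).1, a1, mul_one, mul_one] at q1
    rw [(f_dz k _ _).2.2, (k1 2).2.2, (k2 2).2.2, a3, c3] at q2
    simp at q2
    rw [← q2, ← T_zero] at q1
    exact ((Ex_T k).uniq (q1 ▸ Ex_T 0)).1
  subst hk
  rw [zpow_zero, mul_one] at e e'
  obtain ⟨p0, -⟩ := hu.uniq hc e'
  rw [add_zero] at p0
  have hev : ∀ i, Even (l.count i) := by
    intro i
    apply even_of
    rw [← pl_coeff, ← p0]; rfl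
  obtain ⟨m', hm'⟩ := rels.XL_even l hev
  rw [← pq_fd, ← pq_XL, ← pq_CL] at hm'
  have e2 : pq h = pq (CL fx fd (m' ++ m)) := by
    rw [pq_eq.2 e, map_mul, hm', ← map_mul]
    simp [CL]
  obtain ⟨-, hw⟩ := hu.uniq (U_CL (m' ++ m)) (NN_le (pq_eq.1 e2))
  refine ⟨_, hw, fun hf => ?_⟩
  rw [← pq_one, e2, pq_CL, pq_fd]
  apply rels.CL_even
  intro i
  apply even_of
  rw [← fl_coeff, hf]; rfl

lemma H_scalar {h} (hh : h ∈ HF) (hs : h ∈ KK) : h ∈ NN := by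
  obtain ⟨h0, hh0, hn⟩ := HF_iff.1 hh
  have hs0 : h0 ∈ KK := by
    have := KK.mul_mem hs (KK.inv_mem (NN_le hn))
    simpa using this
  suffices h0 ∈ NN by
    have := NN.mul_mem this hn
    simpa using this
  obtain ⟨u, p, w, k, hu, rfl⟩ := HH_form hh0
  obtain ⟨j, hj⟩ := KK_scal hs0
  obtain ⟨⟨a1, a2, a3⟩, ⟨b1, b2, b3⟩, ⟨c1, c2, c3⟩⟩ := f_one
  have hj := fun i => hj 1 i
  have k1 := fun i => hu 1 i
  simp only [one_mul] at k1 hj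
  have q1 := (hj 0).1
  have q2 := (hj 2).2.2
  rw [(f_dz k _ _).1, (k1 0).1, a1, mul_one, mul_one] at q1
  rw [(f_dz k _ _).2.2, (k1 2).2.2, a3, c3] at q2
  simp at q2
  rw [← q2, ← T_zero] at q1
  have hk := ((Ex_T k).uniq (q1 ▸ Ex_T 0)).1
  subst hk
  rw [zpow_zero, mul_one] at hs0 hh0 ⊢
  obtain ⟨rfl, rfl⟩ := hu.uniq U_one (by simpa using KK.inv_mem hs0)
  obtain ⟨f, hf, hN⟩ := U_NF hh0 hu
  apply hN
  by_contra hne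
  obtain ⟨_, _, ex⟩ := Ex.of_ne hne
  exact (Ex_one_add.mul ex).ne hf.symm

lemma H_col {h} (hh : h ∈ HF) : ∃ k : ℤ, ∀ v i, fa (v * h) i = T k * fa v i := by
  obtain ⟨h0, hh0, hn⟩ := HF_iff.1 hh
  obtain ⟨u, p, w, k, hu, rfl⟩ := HH_form hh0
  obtain ⟨j, hj⟩ := KK_scal (NN_le hn)
  refine ⟨j + k, fun v i => ?_⟩
  have := (hj (v * (u * fd ^ k)) i).1
  have e : v * (u * fd ^ k) * ((u * fd ^ k)⁻¹ * h) = v * h := by group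
  rw [e, ← mul_assoc v, (f_dz k _ _).1, (hu _ _).1, ← mul_assoc, ← T_add] at this
  exact this

end HPart

section Intertwine

lemma mat3 {a b c d e f g h i a' b' c' d' e' f' g' h' i' : R2} (h1 : a = a') (h2 : b = b')
    (h3 : c = c') (h4 : d = d') (h5 : e = e') (h6 : f = f') (h7 : g = g') (h8 : h = h')
    (h9 : i = i') : !![a, b, c; d, e, f; g, h, i] = !![a', b', c'; d', e', f'; g', h', i'] := by
  subst h1 h2 h3 h4 h5 h6 h7 h8 h9; rfl

/-- the original representation -/
def MM : FreeGroup (Fin 2) →* GL (Fin 3) R2 := FreeGroup.lift ![X, Y]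

def Wm : Matrix (Fin 3) (Fin 3) R2 :=
  !![1 + T 1, 1 + T 1, T 1; 0, (1 + T 1) * (1 + T 1), 1 + T 1; 1 + T 1, 1 + T 1, 1]

lemma Wm_det : Wm.det ≠ 0 := by
  have : Wm.det = (1 + T 1) * ((1 + T 1) * ((1 + T 1) * (1 + T 1))) := by
    rw [Wm, Matrix.det_fin_three]
    simp
    grind [two0]
  rw [this]
  exact (Ex_one_add.mul (Ex_one_add.mul (Ex_one_add.mul Ex_one_add))).ne

lemma MM_x : MM fx = X := by simp [MM, fx]
lemma MM_y : MM fy = Y := by simp [MM, fy]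

lemma Tg_Xgi : (Tg * Xg⁻¹).val = !![0, T 1, 0; 1, 1, 1; 0, 1 + T 1, 1] := by
  have : (Tg * Xg⁻¹).val = !![0, T 1, 0; 1, 0, 0; 0, 0, 1] * !![1, 1, 1; 0, 1, 0; 0, 1 + T 1, 1] :=
    rfl
  rw [this, Matrix.mul_fin_three]
  apply mat3 <;> ring

lemma int_x : (MM fx).val * Wm = (T 1 : R2) • (Wm * (P fx).val) := by
  rw [MM_x, P_x]
  change Xmat * Wm = (T 1 : R2) • (Wm * !![1, T 1, 1; 0, 1, 0; 0, 1 + T 1, 1])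
  rw [Xmat, Wm, Matrix.smul_mul, Matrix.mul_fin_three, Matrix.mul_fin_three]
  congr 1
  apply mat3 <;> grind [two0]

lemma int_y : (MM fy).val * Wm = (T 1 : R2) • (Wm * (P fy).val) := by
  rw [MM_y, P_y, Tg_Xgi]
  change Ymat * Wm = _
  rw [Ymat, Wm, Matrix.smul_mul, Matrix.mul_fin_three, Matrix.mul_fin_three]
  congr 1
  apply mat3 <;> grind [two0]

lemma intw (w) : ∃ k : ℤ, (MM w).val * Wm = (T k : R2) • (Wm * (P w).val) := by
  induction w using FreeGroup.induction_on with
  | C1 => exact ⟨0, by simp⟩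
  | of i => fin_cases i; exacts [⟨1, int_x⟩, ⟨1, int_y⟩]
  | inv_of i h =>
    obtain ⟨k, h⟩ := h
    refine ⟨-k, ?_⟩
    have h1 : (MM (FreeGroup.of i)⁻¹).val * (MM (FreeGroup.of i)).val = 1 := by
      rw [← Units.val_mul, ← map_mul]; simp
    have h2 : (P (FreeGroup.of i)).val * (P (FreeGroup.of i)⁻¹).val = 1 := by
      rw [← Units.val_mul, ← map_mul]; simp
    have h3 : (T (-k) * T k : R2) = 1 := by rw [← T_add]; simp
    change (MM (FreeGroup.of i)⁻¹).val * Wm = (T (-k) : R2) • (Wm * (P (FreeGroup.of i)⁻¹).val)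
    generalize (MM (FreeGroup.of i)⁻¹).val = A at *
    generalize (MM (FreeGroup.of i)).val = A' at *
    generalize (P (FreeGroup.of i)⁻¹).val = B at *
    generalize (P (FreeGroup.of i)).val = B' at *
    calc A * Wm = A * Wm * (B' * B) := by rw [h2, mul_one]
      _ = (T (-k) : R2) • (A * ((T k : R2) • (Wm * B')) * B) := by
        rw [Matrix.mul_smul, Matrix.smul_mul, smul_smul, h3, one_smul]; simp only [mul_assoc]
      _ = (T (-k) : R2) • (A * A' * Wm * B) := by rw [← h]; simp only [mul_assoc]
      _ = _ := by rw [h1, one_mul]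
  | mul v w hv hw =>
    obtain ⟨k, hk⟩ := hv
    obtain ⟨j, hj⟩ := hw
    refine ⟨k + j, ?_⟩
    rw [map_mul, map_mul, Units.val_mul, Units.val_mul, mul_assoc, hj, Matrix.mul_smul, ← mul_assoc,
      hk, Matrix.smul_mul, smul_smul, T_add, mul_comm (T j : R2), mul_assoc]

lemma det_cancel {A : Matrix (Fin 3) (Fin 3) R2} (h : Wm.det • A = 0) : A = 0 := by
  ext1 i j
  have := congrFun (congrFun h i) j
  rw [Matrix.smul_apply, smul_eq_mul, Matrix.zero_apply] at this
  exact (mul_eq_zero.1 this).resolve_left Wm_det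

lemma scal_eq (s : R2) : scalar (Fin 3) s = s • (1 : Matrix (Fin 3) (Fin 3) R2) := by
  rw [Matrix.scalar_apply, Matrix.smul_one_eq_diagonal]

lemma MM_center (w) : MM w ∈ Subgroup.center (GL (Fin 3) R2) ↔ w ∈ KK := by
  obtain ⟨k, h⟩ := intw w
  change _ ↔ P w ∈ Subgroup.center (GL (Fin 3) R2)
  have hk : (T (-k) * T k : R2) = 1 := by rw [← T_add]; simp
  rw [Matrix.GeneralLinearGroup.mem_center_iff_val_mem_range_scalar,
    Matrix.GeneralLinearGroup.mem_center_iff_val_mem_range_scalar]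
  generalize (MM w).val = A at *
  generalize (P w).val = B at *
  constructor
  · rintro ⟨s, hs⟩
    refine ⟨T (-k) * s, ?_⟩
    rw [← hs, scal_eq, Matrix.smul_mul, one_mul] at h
    rw [scal_eq, ← sub_eq_zero]
    apply det_cancel
    have h1 : Wm * ((T (-k) * s) • (1 : Matrix (Fin 3) (Fin 3) R2) - B) = 0 := by
      rw [mul_sub, Matrix.mul_smul, mul_one, mul_smul, h, smul_smul, hk, one_smul, sub_self]
    have h2 := congrArg (Wm.adjugate * ·) h1
    rwa [← mul_assoc, Matrix.adjugate_mul, Matrix.smul_mul, one_mul, mul_zero] at h2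
  · rintro ⟨s, hs⟩
    refine ⟨T k * s, ?_⟩
    rw [← hs, scal_eq, Matrix.mul_smul, mul_one, smul_smul] at h
    rw [scal_eq, ← sub_eq_zero]
    apply det_cancel
    have h1 : ((T k * s) • (1 : Matrix (Fin 3) (Fin 3) R2) - A) * Wm = 0 := by
      rw [sub_mul, Matrix.smul_mul, one_mul, h, sub_self]
    have h2 := congrArg (· * Wm.adjugate) h1
    rwa [mul_assoc, Matrix.mul_adjugate, Matrix.mul_smul, mul_one, zero_mul] at h2

end Intertwine

section Main

lemma iso_rhs {z : R2} {l u : ℤ} (h : Ex z l u) :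
    Ex ((1 + T 1) * (z * invert z)) (l - u) (1 + u - l) := by
  have := Ex_one_add.mul (h.mul h.inv)
  have e1 : 0 + (l + -u) = l - u := by ring
  have e2 : 1 + (u + -l) = 1 + u - l := by ring
  rwa [e1, e2] at this

lemma iso1 {g} {lo hi l u : ℤ} (ha : In (fa g 1) lo hi) (hb : In (fb g 1) (lo + 1) hi)
    (hz : Ex (fz g 1) l u) : u - l + 1 ≤ hi - lo := by
  have h := iso_rhs hz
  rw [← isotropic] at h
  have h1 := ((ha.Tmul 1).mul hb.inv).mono (l' := lo + 1 - hi) (h' := hi - lo)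
    (by omega) (by omega)
  have h2 := (ha.inv.mul hb).mono (l' := lo + 1 - hi) (h' := hi - lo)
    (by omega) (by omega)
  have := h.of_In (h1.add h2)
  omega

lemma iso3 {g} {la ha lb hb : ℤ} (ea : Ex (fa g 1) la ha) (eb : Ex (fb g 1) lb hb)
    (h1 : hb ≤ ha) (h2 : lb ≤ la) : ∃ l u, Ex (fz g 1) l u ∧ u - l = ha - lb := by
  have k1 := (ea.Tmul 1).mul eb.inv
  have k2 := ea.inv.inn.mul eb.inn
  have i1 := k1.inn.mono (l' := lb - ha) (h' := 1 + ha - lb) (by omega) (by omega)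
  have i2 := k2.mono (l' := lb - ha) (h' := 1 + ha - lb) (by omega) (by omega)
  have hi := i1.add i2
  have hc : (T 1 * fa g 1 * invert (fb g 1) + invert (fa g 1) * fb g 1).coeff (ha + 1 + -lb) ≠ 0 := by
    rw [coeff_add', k2 _ (by omega), add_zero]
    exact k1.hi
  rw [isotropic] at hi hc
  have hz : fz g 1 ≠ 0 := by
    intro h0
    rw [h0] at hc
    simp at hc
  obtain ⟨l, u, ez⟩ := Ex.of_ne hz
  refine ⟨l, u, ez, ?_⟩
  have r := iso_rhs ez
  have r1 := r.of_In hi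
  have r2 : ¬ (1 + u - l < ha + 1 + -lb) := fun hlt => hc (r.inn _ (Or.inr hlt))
  omega

structure D (g : FreeGroup (Fin 2)) (lo hi : ℤ) : Prop where
  a : Ex (fa g 1) lo hi
  b : In (fb g 1) (lo + 1) hi

inductive SS : FreeGroup (Fin 2) → Prop
  | base (w) : w ∈ HF → SS w
  | step (g h) (lo hi : ℤ) : D g lo hi → SS (g * ft) → h ∈ HF → SS (g * h)

lemma SS.mulH {w h} (hw : SS w) (hh : h ∈ HF) : SS (w * h) := by
  cases hw with
  | base _ hw => exact SS.base _ (HF.mul_mem hw hh)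
  | step g h' lo hi h1 h2 h3 =>
    rw [mul_assoc]
    exact SS.step g _ lo hi h1 h2 (HF.mul_mem h3 hh)

lemma SS_H {w h} (hh : h ∈ HF) : SS (w * h) ↔ SS w :=
  ⟨fun hs => by simpa using hs.mulH (HF.inv_mem hh), fun hs => hs.mulH hh⟩

lemma SS_congr {v w} (h : v⁻¹ * w ∈ HF) : SS v ↔ SS w := by
  have := SS_H (w := v) h
  rw [mul_inv_cancel_left] at this
  exact this.symm

lemma fdk_HF (k : ℤ) : fd ^ k ∈ HF := HF.zpow_mem (HH_le fd_HH) k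
lemma fx_HF : fx ∈ HF := HH_le fx_HH

lemma SS_tt (g) : SS (g * ft * ft) ↔ SS g := by
  rw [mul_assoc, ft2]
  exact SS_H (HH_le fd_HH)

lemma comm_dt (k : ℤ) : Commute (fd ^ k) ft := by
  apply Commute.zpow_left
  rw [← ft2]
  exact Commute.mul_left rfl rfl

lemma SS_dt (g) (k : ℤ) : SS (g * fd ^ k * ft) ↔ SS (g * ft) := by
  rw [mul_assoc, (comm_dt k).eq, ← mul_assoc]
  exact SS_H (fdk_HF k)

lemma y3N : fy ^ 3 ∈ NN := Subgroup.subset_normalClosure (by simp [q42RelsC])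

lemma conj_y3 (g : FreeGroup (Fin 2)) : g * (fy ^ 3) * g⁻¹ ∈ NN :=
  Subgroup.Normal.conj_mem inferInstance _ y3N g

def Mp (n : ℤ) : Prop := ∀ g l h, h - l + 1 < n → In (fa g 1) l h → In (fb g 1) l h →
  (SS g ↔ SS (g * ft))

structure Al (g : FreeGroup (Fin 2)) (l m : ℤ) : Prop where
  a : Ex (fa g 1) l (l + m)
  b : In (fb g 1) (l + 1) (l + m)
  z : In (fz g 1) l (l + m - 1)

lemma Ex.cast {f : R2} {l h l' h' : ℤ} (e : Ex f l h) (h1 : l = l') (h2 : h = h') : Ex f l' h' := by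
  subst h1 h2; exact e

lemma al_step {n : ℤ} (hM : Mp n) {g l m} (h : Al g l m) (hm : m + 1 ≤ n) :
    ∃ u ∈ HH, Al (g * u) (l + 1) m ∧ (SS (g * ft) ↔ SS (g * u * ft)) := by
  have hm0 := h.a.le
  by_cases hz : (fz g 1).coeff l = 0
  · refine ⟨fd, fd_HH, ⟨?_, ?_, ?_⟩, ?_⟩
    · rw [fa_d]
      exact (h.a.Tmul 1).cast rfl (by ring)
    · rw [fb_d]
      exact (h.b.Tmul 1).mono (by omega) (by omega)
    · rw [fz_d]
      intro k hk
      by_cases hkl : k = l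
      · rw [hkl]; exact hz
      · exact h.z k (by omega)
    · have := SS_dt g 1
      rw [zpow_one] at this
      exact this.symm
  · have hb' : In (fb (g * fx⁻¹) 1) (l + 1) (l + m) := by
      rw [fb_xi]
      intro k hk
      rw [add_mul, one_mul, coeff_add', coeff_add', coeff_add', coeff_Tmul, h.b k hk, zero_add,
        h.z (k - 1) (by
          by_contra hc
          have : l < k := by omega
          omega), add_zero]
      by_cases hkl : k = l
      · rw [hkl]; exact z2 h.a.lo hz
      · rw [h.a.inn k (by omega), h.z k (by omega), add_zero]
    have hz' : In (fz (g * fx⁻¹) 1) (l + 1) (l + m) := by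
      rw [fz_xi]
      intro k hk
      rw [coeff_add']
      by_cases hkl : k = l
      · rw [hkl]; exact z2 hz h.a.lo
      · rw [h.a.inn k (by omega), h.z k (by omega), add_zero]
    refine ⟨fx⁻¹ * fd, HH.mul_mem (HH.inv_mem fx_HH) fd_HH, ⟨?_, ?_, ?_⟩, ?_⟩
    · rw [← mul_assoc, fa_d, fa_xi]
      exact (h.a.Tmul 1).cast rfl (by ring)
    · rw [← mul_assoc, fb_d]
      exact (hb'.Tmul 1).mono (by omega) (by omega)
    · rw [← mul_assoc, fz_d]
      exact hz'.mono (by omega) (by omega)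
    · have e1 : SS (g * (fx⁻¹ * fd) * ft) ↔ SS (g * fx⁻¹ * ft) := by
        have := SS_dt (g * fx⁻¹) 1
        rwa [zpow_one, mul_assoc g] at this
      rw [e1]
      have ka : In (fa (g * fx⁻¹ * ft * fx⁻¹) 1) (l + 1) (l + m) := by
        rw [fa_xi, fa_t]; exact hb'
      have kb : In (fb (g * fx⁻¹ * ft * fx⁻¹) 1) (l + 1) (l + m) := by
        have : fb (g * fx⁻¹ * ft * fx⁻¹) 1 = fb g 1 := by
          rw [fb_xi, fb_t, fz_t, fa_t, fa_xi, fb_xi, fz_xi]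
          grind [two0]
        rw [this]; exact h.b
      have k := hM _ _ _ (by omega) ka kb
      rw [SS_H (HF.inv_mem fx_HF)] at k
      rw [k]
      -- kappa t ~ g t⁻¹ x
      have e2 : SS (g * fx⁻¹ * ft * fx⁻¹ * ft) ↔ SS (g * ft⁻¹ * fx) := by
        apply SS_congr
        apply NN_le_HF
        have := NN.inv_mem (conj_y3 fx⁻¹)
        convert this using 1
        simp only [ft]; group
      rw [e2, SS_H fx_HF]
      have := SS_tt (g * ft⁻¹)
      rwa [inv_mul_cancel_right] at this

lemma al_iter {n : ℤ} (hM : Mp n) {g l m} (h : Al g l m) (hm : m + 1 ≤ n) (j : ℕ) :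
    ∃ u ∈ HH, Al (g * u) (l + j) m ∧ (SS (g * ft) ↔ SS (g * u * ft)) := by
  induction j with
  | zero => exact ⟨1, HH.one_mem, by simpa using h, by simp⟩
  | succ j ih =>
    obtain ⟨u, hu, h1, h2⟩ := ih
    obtain ⟨u', hu', h3, h4⟩ := al_step hM h1 hm
    rw [mul_assoc] at h3
    rw [mul_assoc g u u'] at h4
    refine ⟨u * u', HH.mul_mem hu hu', ?_, h2.trans h4⟩
    have e : l + ((j + 1 : ℕ) : ℤ) = l + j + 1 := by push_cast; ring
    rw [e]; exact h3

lemma D.al {g lo hi} (h : D g lo hi) : ∃ k l : ℤ, Al (g * fd ^ k) l (hi - lo) := by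
  by_cases hz : fz g 1 = 0
  · refine ⟨0, lo, ?_⟩
    rw [zpow_zero, mul_one]
    exact ⟨h.a.cast rfl (by ring), h.b.mono (by omega) (by omega), by rw [hz]; exact In_zero _ _⟩
  · obtain ⟨c, e, ez⟩ := Ex.of_ne hz
    have h1 := iso1 h.a.inn h.b ez
    obtain ⟨d1, d2, d3⟩ := f_dz (c - lo) g 1
    refine ⟨c - lo, c, ?_, ?_, ?_⟩
    · rw [d1]; exact (h.a.Tmul _).cast (by ring) (by ring)
    · rw [d2]; exact (h.b.Tmul _).mono (by omega) (by omega)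
    · rw [d3]; exact ez.inn.mono (by omega) (by omega)

lemma add_cancel {a b : R2} {l h : ℤ} (h1 : In a l h) (h2 : In (a + b) l h) : In b l h := by
  have := h1.add h2
  rwa [← add_assoc, dbl, zero_add] at this

lemma al_same {g h l m} (h1 : Al g l m) (h2 : Al (g * h) l m) (hh : h ∈ HH) : h ∈ NN := by
  obtain ⟨u, p, w, k, hu, rfl⟩ := HH_form hh
  have hk : k = 0 := by
    have := h2.a
    rw [← mul_assoc, (f_dz k _ _).1, (hu _ _).1] at this
    have := (this.uniq (h1.a.Tmul k)).1
    omega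
  subst hk
  rw [zpow_zero, mul_one] at *
  obtain ⟨u1, u2, u3⟩ := hu g 1
  have hp : p = 0 := by
    by_contra hp
    obtain ⟨c, e, ep⟩ := Ex.of_ne hp
    have h3 := h2.z
    rw [u3] at h3
    have := (ep.mul h1.a).of_In (add_cancel h1.z h3)
    have := ep.le
    omega
  subst hp
  obtain ⟨f, rfl, hf⟩ := U_NF hh hu
  apply hf
  by_contra hne
  obtain ⟨c, e, ef⟩ := Ex.of_ne hne
  have h3 := h2.b
  rw [u2, map_zero, mul_zero, zero_mul, add_zero] at h3
  have := ((Ex_one_add.mul ef).mul h1.a).of_In (add_cancel h1.b h3)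
  have := ef.le
  omega

lemma transfer {n : ℤ} (hM : Mp n) {g h lo hi lo' hi'} (h1 : D g lo hi) (hn : hi - lo + 1 ≤ n)
    (h2 : D (g * h) lo' hi') (hh : h ∈ HF) : SS (g * ft) ↔ SS (g * h * ft) := by
  have conjN : ∀ (g h : FreeGroup (Fin 2)), h ∈ NN → (SS (g * ft) ↔ SS (g * h * ft)) := by
    intro g h hN
    apply SS_congr
    apply NN_le_HF
    have := Subgroup.Normal.conj_mem (inferInstance : NN.Normal) _ hN ft⁻¹
    convert this using 1
    group
  obtain ⟨h0, hh0, hN⟩ := HF_iff.1 hh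
  have e0 : g * h0 * (h0⁻¹ * h) = g * h := by group
  have e1 := conjN (g * h0) _ hN
  rw [e0] at e1
  rw [← e1]
  -- D for g * h0
  obtain ⟨j, hj⟩ := KK_scal (NN_le hN)
  obtain ⟨j1, j2, j3⟩ := hj (g * h0) 1
  rw [e0] at j1 j2 j3
  have cancel : ∀ f : R2, f = T (-j) * (T j * f) := by
    intro f; rw [← mul_assoc, ← T_add]; simp
  have h2' : D (g * h0) (lo' + -j) (hi' + -j) := by
    refine ⟨?_, ?_⟩
    · rw [cancel (fa (g * h0) 1), ← j1]; exact h2.a.Tmul _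
    · rw [cancel (fb (g * h0) 1), ← j2]; exact (h2.b.Tmul _).mono (by omega) (by omega)
  -- spans agree
  obtain ⟨k, hk⟩ := H_col (HH_le hh0)
  have ea := h2'.a
  rw [hk] at ea
  have sp := ea.uniq (h1.a.Tmul k)
  obtain ⟨k1, l1, A1⟩ := h1.al
  obtain ⟨k2, l2, A2⟩ := h2'.al
  have esp : hi' + -j - (lo' + -j) = hi - lo := by omega
  rw [esp] at A2
  rw [← SS_dt g k1, ← SS_dt (g * h0) k2]
  obtain ⟨q1, hq1⟩ : ∃ q : ℕ, (q : ℤ) = max l1 l2 - l1 := ⟨(max l1 l2 - l1).toNat, by omega⟩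
  obtain ⟨q2, hq2⟩ : ∃ q : ℕ, (q : ℤ) = max l1 l2 - l2 := ⟨(max l1 l2 - l2).toNat, by omega⟩
  obtain ⟨u1, hu1, B1, s1⟩ := al_iter hM A1 hn q1
  obtain ⟨u2, hu2, B2, s2⟩ := al_iter hM A2 hn q2
  rw [hq1, add_sub_cancel] at B1
  rw [hq2, add_sub_cancel] at B2
  rw [s1, s2]
  have ev : g * h0 * fd ^ k2 * u2 =
      (g * fd ^ k1 * u1) * ((fd ^ k1 * u1)⁻¹ * (h0 * fd ^ k2 * u2)) := by group
  rw [ev] at B2 ⊢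
  apply conjN
  apply al_same B1 B2
  exact HH.mul_mem (HH.inv_mem (HH.mul_mem (HH.zpow_mem fd_HH _) hu1))
    (HH.mul_mem (HH.mul_mem hh0 (HH.zpow_mem fd_HH _)) hu2)

lemma fa_H_zero {w} (hw : w ∈ HF) : fa w 1 = 0 := by
  obtain ⟨k, hk⟩ := H_col hw
  have := hk 1 1
  rw [one_mul, f_one.1.2.1, mul_zero] at this
  exact this

lemma type1 {n : ℤ} (hM : Mp n) {g lo hi} (h : D g lo hi) (hn : hi - lo + 1 ≤ n) :
    SS g ↔ SS (g * ft) := by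
  constructor
  · intro hs
    cases hs with
    | base _ hw => exact absurd (fa_H_zero hw) h.a.ne
    | step g0 h0 lo0 hi0 d0 s0 hh =>
      have e : g0 = g0 * h0 * h0⁻¹ := by group
      have := transfer hM h hn (h := h0⁻¹) (by rw [← e]; exact d0) (HF.inv_mem hh)
      rw [← e] at this
      exact this.2 s0
  · intro hs
    have := SS.step g 1 lo hi h hs HF.one_mem
    rwa [mul_one] at this

lemma type3' {n : ℤ} (hM : Mp n) {g la ha lb hb} (ea : Ex (fa g 1) la ha) (eb : Ex (fb g 1) lb hb)
    (ez : Ex (fz g 1) lb ha)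
    (h1 : hb ≤ ha) (h2 : lb ≤ la) (hn : ha - lb + 1 ≤ n) : SS g ↔ SS (g * ft) := by
  have hc : In (fb (g * fx) 1) (lb + 1) ha := by
    rw [fb_x]
    intro k hk
    rw [add_mul, one_mul, coeff_add', coeff_add', coeff_add', coeff_Tmul, coeff_Tmul]
    by_cases hkl : k ≤ lb
    · rw [ea.inn (k - 1) (by omega), ez.inn (k - 1) (by omega), add_zero, add_zero]
      by_cases hkl' : k = lb
      · rw [hkl']; exact z2 eb.lo ez.lo
      · rw [eb.inn k (by omega), ez.inn k (by omega), add_zero]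
    · rw [eb.inn k (by omega), ez.inn k (by omega), zero_add, zero_add]
      by_cases hkl' : k = ha + 1
      · rw [hkl', add_sub_cancel_right]; exact z2 ea.hi ez.hi
      · rw [ea.inn (k - 1) (by omega), ez.inn (k - 1) (by omega), add_zero]
  have s1 : SS (g * fx) ↔ SS (g * fx * ft) := by
    by_cases hl : lb < la
    · refine hM _ (lb + 1) ha (by omega) ?_ hc
      rw [fa_x]
      exact ea.inn.mono (by omega) (by omega)
    · have hl' : la = lb := by omega
      subst hl'
      refine type1 hM (lo := la) (hi := ha) ⟨?_, hc⟩ hn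
      rw [fa_x]; exact ea
  rw [SS_H fx_HF] at s1
  have kc : fb (g * ft * fx⁻¹) 1 = fb (g * fx) 1 := by
    rw [fb_xi, fb_x, fb_t, fa_t, fz_t]; ring
  have s2 : SS (g * ft * fx⁻¹) ↔ SS (g * ft * fx⁻¹ * ft) := by
    by_cases hl : hb < ha
    · have k := hM (g * ft * fx⁻¹ * ft) (lb + 1) ha (by omega)
        (by rw [fa_t, kc]; exact hc)
        (by rw [fb_t, fa_xi, fa_t]; exact (eb.inn.Tmul 1).mono (by omega) (by omega))
      rw [SS_tt] at k
      exact k.symm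
    · have hl' : hb = ha := by omega
      subst hl'
      refine type1 hM (lo := lb) (hi := hb) ⟨?_, ?_⟩ (by omega)
      · rw [fa_xi, fa_t]; exact eb
      · rw [kc]; exact hc
  rw [SS_H (HF.inv_mem fx_HF)] at s2
  have e2 : SS (g * ft * fx⁻¹ * ft) ↔ SS (g * fx * ft⁻¹ * fx) := by
    apply SS_congr
    apply NN_le_HF
    have := NN.inv_mem (conj_y3 fx⁻¹)
    convert this using 1
    simp only [ft]; group
  rw [SS_H fx_HF] at e2
  have e3 := SS_tt (g * fx * ft⁻¹)
  rw [inv_mul_cancel_right] at e3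
  rw [s1, s2, e2, e3]

lemma type3 {n : ℤ} (hM : Mp n) {g la ha lb hb} (ea : Ex (fa g 1) la ha) (eb : Ex (fb g 1) lb hb)
    (h1 : hb ≤ ha) (h2 : lb ≤ la) (hn : ha - lb + 1 ≤ n) : SS g ↔ SS (g * ft) := by
  obtain ⟨l, u, ez, hs⟩ := iso3 ea eb h1 h2
  -- normalise
  obtain ⟨d1, d2, d3⟩ := f_dz (l - lb) g 1
  have eg : SS g ↔ SS (g * fd ^ (l - lb)) := (SS_H (fdk_HF _)).symm
  rw [eg, ← SS_dt g (l - lb)]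
  have ea' := ea.Tmul (l - lb)
  have eb' := eb.Tmul (l - lb)
  have ez' := ez
  rw [← d1] at ea'
  rw [← d2] at eb'
  rw [← d3] at ez'
  clear eg d1 d2 d3
  generalize g * fd ^ (l - lb) = g at *
  exact type3' hM ea' eb' (ez'.cast (by omega) (by omega)) (by omega) (by omega) (by omega)

lemma Mp_step {n : ℤ} (hM : Mp n) : Mp (n + 1) := by
  intro g l h hn ia ib
  by_cases ha0 : fa g 1 = 0
  · by_cases hb0 : fb g 1 = 0
    · exact (row_ne g ha0 hb0).elim
    · obtain ⟨lb, hb, eb⟩ := Ex.of_ne hb0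
      have b1 := eb.of_In ib
      have k := type1 hM (g := g * ft) (lo := lb) (hi := hb)
        ⟨by rw [fa_t]; exact eb, by rw [fb_t, ha0, mul_zero]; exact In_zero _ _⟩ (by omega)
      rw [SS_tt] at k
      exact k.symm
  · obtain ⟨la, ha, ea⟩ := Ex.of_ne ha0
    have a1 := ea.of_In ia
    by_cases hb0 : fb g 1 = 0
    · exact type1 hM (lo := la) (hi := ha) ⟨ea, by rw [hb0]; exact In_zero _ _⟩ (by omega)
    · obtain ⟨lb, hb, eb⟩ := Ex.of_ne hb0
      have b1 := eb.of_In ib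
      by_cases c1 : hb ≤ ha
      · by_cases c2 : lb ≤ la
        · exact type3 hM ea eb c1 c2 (by omega)
        · exact type1 hM (lo := la) (hi := ha) ⟨ea, eb.inn.mono (by omega) (by omega)⟩ (by omega)
      · have fa' : Ex (fa (g * ft) 1) lb hb := by rw [fa_t]; exact eb
        have fb' : Ex (fb (g * ft) 1) (la + 1) (ha + 1) := by rw [fb_t]; exact ea.Tmul 1
        have k : SS (g * ft) ↔ SS (g * ft * ft) := by
          by_cases c2 : lb ≤ la
          · exact type1 hM (lo := lb) (hi := hb) ⟨fa', fb'.inn.mono (by omega) (by omega)⟩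
              (by omega)
          · exact type3 hM fa' fb' (by omega) (by omega) (by omega)
        rw [SS_tt] at k
        exact k.symm

lemma In_neg {f : R2} {l h : ℤ} (hf : In f l h) (hh : h < l) : f = 0 := by
  by_contra hc
  obtain ⟨l', h', e⟩ := Ex.of_ne hc
  have := e.of_In hf
  have := e.le
  omega

lemma Mp_all (n : ℕ) : Mp n := by
  induction n with
  | zero =>
    intro g l h hn ia ib
    push_cast at hn
    exact (row_ne g (In_neg ia (by omega)) (In_neg ib (by omega))).elim
  | succ n ih =>
    push_cast
    exact Mp_step ih

lemma In_ex (f : R2) : ∃ l h, In f l h := by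
  by_cases hf : f = 0
  · exact ⟨0, 0, by rw [hf]; exact In_zero _ _⟩
  · obtain ⟨l, h, e⟩ := Ex.of_ne hf
    exact ⟨l, h, e.inn⟩

lemma SS_t (g) : SS (g * ft) ↔ SS g := by
  obtain ⟨l1, h1, i1⟩ := In_ex (fa g 1)
  obtain ⟨l2, h2, i2⟩ := In_ex (fb g 1)
  exact (Mp_all ((max h1 h2 - min l1 l2 + 2).toNat) g (min l1 l2) (max h1 h2) (by omega)
    (i1.mono (by omega) (by omega)) (i2.mono (by omega) (by omega))).symm

lemma SS_all (w) : SS w := by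
  have : ∀ g, SS (g * w) ↔ SS g := by
    refine word_ind (fun w => ∀ g, SS (g * w) ↔ SS g) ?_ ?_ ?_ ?_ ?_ w
    · intro g; rw [mul_one]
    · intro g; exact SS_H fx_HF
    · exact SS_t
    · intro w hw g
      have := hw (g * w⁻¹)
      rw [inv_mul_cancel_right] at this
      exact this.symm
    · intro v w hv hw g
      rw [← mul_assoc, hw, hv]
  have h := this 1
  rw [one_mul] at h
  exact h.2 (SS.base 1 HF.one_mem)

lemma KK_le {w} (hw : w ∈ KK) : w ∈ NN := by
  have h0 : fa w 1 = 0 := by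
    obtain ⟨k, hk⟩ := KK_scal hw
    have := (hk 1 1).1
    rw [one_mul, f_one.1.2.1, mul_zero] at this
    exact this
  cases SS_all w with
  | base _ hH => exact H_scalar hH hw
  | step g h lo hi hd _ hh =>
    obtain ⟨k, hk⟩ := H_col hh
    rw [hk] at h0
    exact absurd h0 (hd.a.Tmul k).ne

end Main

/-- **Lemma A.6.** `Q_{4,2}` is presented by generators `x, y` with relations `1_o)`,
`1_b)`, `2_o′)`: the homomorphism from the free group on `x, y` sending `x ↦ p(X)`,
`y ↦ p(Y)` has range `Q_{4,2}` and kernel the normal closure of the relators. -/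
theorem statement15 :
    (FreeGroup.lift ![pp X, pp Y]).range = Q42 ∧
      (FreeGroup.lift ![pp X, pp Y]).ker = Subgroup.normalClosure q42RelsC := by
  constructor
  · rw [FreeGroup.range_lift_eq_closure, Q42]
    congr 1
    ext z
    simp [eq_comm]
    tauto
  · have e : FreeGroup.lift ![pp X, pp Y] = pp.comp MM := by
      apply FreeGroup.ext_hom
      intro i
      fin_cases i <;> simp [MM]
    rw [e]
    ext w
    rw [MonoidHom.mem_ker, MonoidHom.comp_apply, pp, QuotientGroup.mk'_apply,
      QuotientGroup.eq_one_iff, MM_center]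
    exact ⟨fun h => KK_le h, fun h => NN_le h⟩
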